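/- Let N ≥ 1, 0 ≤ δ < ρ ≤ 1, and m < 0. Let σ : ℝ^N × ℝ^N → ℂ be a symbol of class S^m_{ρ,δ}(ℝ^N × ℝ^N) with σ(x,ξ) = 0 for x outside some compact set K₀ ⊆ ℝ^N. Then A_σ extends to a bounded operator on L²(ℝ^N), and this extension is a compact operator. (Second part of Proposition 5.2 of the paper: compactly supported pseudodifferential operators of negative order are compact on L².) -/

import Mathlib

open MeasureTheory Filter

/-- Partial derivative of a symbol `a(x, θ)` in the `i`-th coordinate of the
spatial variable `x`. -/
noncomputable def pdX {n N : ℕ} (i : Fin n)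
    (a : (Fin n → ℝ) → (Fin N → ℝ) → ℂ) : (Fin n → ℝ) → (Fin N → ℝ) → ℂ :=
  fun x θ => fderiv ℝ (fun x' => a x' θ) x (Pi.single i 1)

/-- Partial derivative of a symbol `a(x, θ)` in the `i`-th coordinate of the
frequency variable `θ`. -/
noncomputable def pdTheta {n N : ℕ} (i : Fin N)
    (a : (Fin n → ℝ) → (Fin N → ℝ) → ℂ) : (Fin n → ℝ) → (Fin N → ℝ) → ℂ :=
  fun x θ => fderiv ℝ (fun θ' => a x θ') θ (Pi.single i 1)

/-- The iterated partial derivative `∂^α_θ ∂^β_x a` of a symbol, where the multi-indices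
`α`, `β` are recorded as lists `Lθ`, `Lx` of coordinate directions (the length of the list
is the total order `|α|`, resp. `|β|`, of the multi-index). -/
noncomputable def symbolDeriv {n N : ℕ} (Lx : List (Fin n)) (Lθ : List (Fin N))
    (a : (Fin n → ℝ) → (Fin N → ℝ) → ℂ) : (Fin n → ℝ) → (Fin N → ℝ) → ℂ :=
  Lx.foldr pdX (Lθ.foldr pdTheta a)

/-- The japanese-bracket weight `⟨θ⟩^s = (1 + |θ|²)^(s/2)`. -/
noncomputable def jweight {N : ℕ} (s : ℝ) (θ : Fin N → ℝ) : ℝ :=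
  (1 + ‖θ‖ ^ 2) ^ (s / 2 : ℝ)

/-- The Hörmander class `S^m_{ρ,δ}(W × ℝ^N)`: `a` is smooth on `W × ℝ^N` and every iterated
derivative `∂^α_θ ∂^β_x a` is bounded on `K × ℝ^N` (`K ⊆ W` compact) by a constant times
`⟨θ⟩^(m - ρ|α| + δ|β|)`. -/
def IsHormanderSymbol {n N : ℕ} (ρ δ m : ℝ) (W : Set (Fin n → ℝ))
    (a : (Fin n → ℝ) → (Fin N → ℝ) → ℂ) : Prop :=
  ContDiffOn ℝ (⊤ : ℕ∞) (fun p : (Fin n → ℝ) × (Fin N → ℝ) => a p.1 p.2) (W ×ˢ Set.univ) ∧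
  ∀ K : Set (Fin n → ℝ), K ⊆ W → IsCompact K →
    ∀ (Lx : List (Fin n)) (Lθ : List (Fin N)), ∃ C : ℝ, 0 ≤ C ∧
      ∀ x ∈ K, ∀ θ : Fin N → ℝ,
        ‖symbolDeriv Lx Lθ a x θ‖ ≤
          C * jweight (m - ρ * (Lθ.length : ℝ) + δ * (Lx.length : ℝ)) θ

/-- A continuous family over `T` with values in `S^m_{ρ,δ}(W × ℝ^N)` : each `a t` lies in the
class, and `t ↦ a t` is continuous for the Fréchet seminorm topology, i.e. for each `t₀`,
compact `K ⊆ W` and multi-indices, the corresponding seminorm of `a t - a t₀` is eventually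
smaller than any `ε > 0`. -/
def IsContinuousSymbolFamily {T : Type*} [TopologicalSpace T] {n N : ℕ}
    (ρ δ m : ℝ) (W : Set (Fin n → ℝ))
    (a : T → (Fin n → ℝ) → (Fin N → ℝ) → ℂ) : Prop :=
  (∀ t, IsHormanderSymbol ρ δ m W (a t)) ∧
  ∀ t₀ : T, ∀ K : Set (Fin n → ℝ), K ⊆ W → IsCompact K →
    ∀ (Lx : List (Fin n)) (Lθ : List (Fin N)), ∀ ε : ℝ, 0 < ε →
      ∀ᶠ t in nhds t₀, ∀ x ∈ K, ∀ θ : Fin N → ℝ,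
        ‖symbolDeriv Lx Lθ (fun x' θ' => a t x' θ' - a t₀ x' θ') x θ‖ ≤
          ε * jweight (m - ρ * (Lθ.length : ℝ) + δ * (Lx.length : ℝ)) θ

/-- The dot product `x · ξ = ∑ i, x i * ξ i` on `ℝ^N`. -/
noncomputable def dotProd {N : ℕ} (x ξ : Fin N → ℝ) : ℝ := ∑ i, x i * ξ i

/-- The Fourier transform `𝓕 f (ξ) = ∫ e^{-2πi y·ξ} f(y) dy`. -/
noncomputable def fourierT {N : ℕ} (f : (Fin N → ℝ) → ℂ) (ξ : Fin N → ℝ) : ℂ :=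
  ∫ y : Fin N → ℝ, Complex.exp (-(2 * (Real.pi : ℂ) * Complex.I * (dotProd y ξ : ℂ))) * f y

/-- The pseudodifferential operator with symbol `σ`:
`A_σ f (x) = ∫ e^{2πi x·ξ} σ(x,ξ) 𝓕f(ξ) dξ`. -/
noncomputable def pdoApply {N : ℕ} (σ : (Fin N → ℝ) → (Fin N → ℝ) → ℂ)
    (f : (Fin N → ℝ) → ℂ) (x : Fin N → ℝ) : ℂ :=
  ∫ ξ : Fin N → ℝ,
    Complex.exp (2 * (Real.pi : ℂ) * Complex.I * (dotProd x ξ : ℂ)) * σ x ξ * fourierT f ξ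

open scoped FourierTransform SchwartzMap ENNReal RealInnerProductSpace Topology ContDiff

/-! ### The Fourier transform on `L¹ ∩ L²` -/

section Fourier

variable {N : ℕ}

/-- On `L¹ ∩ L²`, the `L²` Fourier transform is given by the Fourier integral. -/
theorem fourier_toLp_ae_eq {V : Type*} [NormedAddCommGroup V] [InnerProductSpace ℝ V]
    [FiniteDimensional ℝ V] [MeasurableSpace V] [BorelSpace V] {q : V → ℂ}
    (hq : Integrable q) (hq2 : MemLp q 2) :
    ⇑(𝓕 (hq2.toLp q) : Lp ℂ 2 (volume : Measure V)) =ᵐ[volume] 𝓕 q := by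
  refine ae_eq_of_integral_contDiff_smul_eq ?_ ?_ ?_
  · exact (Lp.memLp _).locallyIntegrable (by norm_num)
  · refine Continuous.locallyIntegrable ?_
    exact VectorFourier.fourierIntegral_continuous Real.continuous_fourierChar
      (by exact continuous_inner) hq
  · intro g hg hgc
    have hgc' : HasCompactSupport (fun x => (g x : ℂ)) :=
      hgc.comp_left (g := fun r : ℝ => (r : ℂ)) Complex.ofReal_zero
    have hgd : ContDiff ℝ ∞ (fun x => (g x : ℂ)) := Complex.ofRealCLM.contDiff.comp hg
    set ψ : 𝓢(V, ℂ) := hgc'.toSchwartzMap hgd with hψ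
    have hψg : ∀ x, ψ x = (g x : ℂ) := fun x => rfl
    have h1 := congrArg (fun T => T ψ) (Lp.fourier_toTemperedDistribution_eq (hq2.toLp q))
    simp only [TemperedDistribution.fourier_apply, Lp.toTemperedDistribution_apply] at h1
    have h2 : ∫ x, g x • (𝓕 (hq2.toLp q) : Lp ℂ 2 (volume : Measure V)) x
        = ∫ x, ψ x • (𝓕 (hq2.toLp q) : Lp ℂ 2 (volume : Measure V)) x := by
      simp [hψg]
    rw [h2, ← h1]
    have h3 : ∫ x, (𝓕 ψ) x • (hq2.toLp q) x = ∫ x, (𝓕 (ψ : V → ℂ)) x • q x := by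
      refine integral_congr_ae ?_
      filter_upwards [hq2.coeFn_toLp] with x hx
      rw [hx, SchwartzMap.fourier_coe]
    rw [h3]
    have h4 := VectorFourier.integral_fourierIntegral_smul_eq_flip (μ := (volume : Measure V))
      (ν := (volume : Measure V)) (f := (ψ : V → ℂ)) (g := q) (L := innerₗ V)
      (e := Real.fourierChar) Real.continuous_fourierChar (by exact continuous_inner)
      ψ.integrable hq
    rw [flip_innerₗ] at h4
    refine h4.trans (integral_congr_ae (.of_forall fun x => ?_))
    simp only [hψg]
    rw [Complex.real_smul, smul_eq_mul]
    rfl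

theorem dotProd_eq_inner (x y : EuclideanSpace ℝ (Fin N)) :
    dotProd x.ofLp y.ofLp = ⟪x, y⟫ := by
  simp [dotProd, PiLp.inner_apply, mul_comm]

theorem fourierT_ofLp (q : (Fin N → ℝ) → ℂ) (ξ : EuclideanSpace ℝ (Fin N)) :
    fourierT q ξ.ofLp = 𝓕 (fun y : EuclideanSpace ℝ (Fin N) => q y.ofLp) ξ := by
  rw [Real.fourier_eq', fourierT,
    ← (PiLp.volume_preserving_ofLp (Fin N)).integral_comp
      (MeasurableEquiv.toLp 2 (Fin N → ℝ)).symm.measurableEmbedding]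
  refine integral_congr_ae (.of_forall fun y => ?_)
  simp only [dotProd_eq_inner, smul_eq_mul]
  congr 2
  push_cast
  ring

/-- The unitary Fourier transform of `L²(ℝ^N)`. -/
noncomputable def fourierL2 (N : ℕ) :
    Lp ℂ 2 (volume : Measure (Fin N → ℝ)) →ₗᵢ[ℂ] Lp ℂ 2 (volume : Measure (Fin N → ℝ)) :=
  (Lp.compMeasurePreservingₗᵢ ℂ _ (PiLp.volume_preserving_toLp (Fin N))).comp
    ((Lp.fourierTransformₗᵢ (EuclideanSpace ℝ (Fin N)) ℂ).toLinearIsometry.comp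
      (Lp.compMeasurePreservingₗᵢ ℂ _ (PiLp.volume_preserving_ofLp (Fin N))))

theorem fourierL2_ae_eq {q : (Fin N → ℝ) → ℂ} (hq : Integrable q) (hq2 : MemLp q 2) :
    ⇑(fourierL2 N (hq2.toLp q)) =ᵐ[volume] fourierT q := by
  have hp := PiLp.volume_preserving_ofLp (Fin N)
  have hp' := PiLp.volume_preserving_toLp (Fin N)
  have e1 : Lp.compMeasurePreserving _ hp (hq2.toLp q)
      = (hq2.comp_measurePreserving hp).toLp _ := Lp.toLp_compMeasurePreserving hq2 hp
  have e2 : fourierL2 N (hq2.toLp q)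
      = Lp.compMeasurePreserving _ hp' (𝓕 ((hq2.comp_measurePreserving hp).toLp _) : Lp ℂ 2 _) := by
    rw [← e1]; rfl
  rw [e2]
  have hi : Integrable (q ∘ (WithLp.ofLp : EuclideanSpace ℝ (Fin N) → _)) :=
    hp.integrable_comp_of_integrable hq
  have h3 := hp'.quasiMeasurePreserving.ae_eq_comp
    (fourier_toLp_ae_eq hi (hq2.comp_measurePreserving hp))
  refine (Lp.coeFn_compMeasurePreserving _ hp').trans (h3.trans (.of_forall fun ξ => ?_))
  exact (fourierT_ofLp q (WithLp.toLp 2 ξ)).symm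

/-- The Plancherel identity on `L¹ ∩ L²`. -/
theorem eLpNorm_fourierT {q : (Fin N → ℝ) → ℂ} (hq : Integrable q) (hq2 : MemLp q 2) :
    eLpNorm (fourierT q) 2 volume = eLpNorm q 2 volume := by
  rw [← eLpNorm_congr_ae (fourierL2_ae_eq hq hq2), ← eLpNorm_congr_ae hq2.coeFn_toLp]
  have := (fourierL2 N).norm_map (hq2.toLp q)
  rw [Lp.norm_def, Lp.norm_def] at this
  exact (ENNReal.toReal_eq_toReal_iff' (Lp.eLpNorm_ne_top _) (Lp.eLpNorm_ne_top _)).1 this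

/-- Every Schwartz function is the Fourier integral of a function in `L¹ ∩ L²`. -/
theorem exists_fourierT_eq (h : 𝓢(Fin N → ℝ, ℂ)) :
    ∃ f : (Fin N → ℝ) → ℂ, Integrable f ∧ MemLp f 2 ∧ fourierT f = h := by
  let e := (EuclideanSpace.equiv (Fin N) ℝ)
  let hE : 𝓢(EuclideanSpace ℝ (Fin N), ℂ) := SchwartzMap.compCLMOfContinuousLinearEquiv ℂ e h
  let f : 𝓢(Fin N → ℝ, ℂ) := SchwartzMap.compCLMOfContinuousLinearEquiv ℂ e.symm (𝓕⁻ hE)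
  refine ⟨f, f.integrable, f.memLp 2, funext fun ξ => ?_⟩
  have h1 := fourierT_ofLp (f : (Fin N → ℝ) → ℂ) (WithLp.toLp 2 ξ)
  have h2 : (fun y : EuclideanSpace ℝ (Fin N) => f y.ofLp) = (𝓕⁻ hE : 𝓢(_, ℂ)) := by
    ext y; rfl
  rw [h2, ← SchwartzMap.fourier_coe, FourierTransform.fourier_fourierInv_eq] at h1
  exact h1

end Fourier

/-! ### Integral operators with continuous compactly supported kernels -/

section KernelOperator

variable {N : ℕ}

/-- A continuous compactly supported kernel is dominated by a multiple of the indicator of a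
product of compact sets. -/
theorem exists_kernel_bound {k : (Fin N → ℝ) → (Fin N → ℝ) → ℂ}
    (hk : Continuous (fun p : (Fin N → ℝ) × (Fin N → ℝ) => k p.1 p.2))
    (hkc : HasCompactSupport (fun p : (Fin N → ℝ) × (Fin N → ℝ) => k p.1 p.2)) :
    ∃ (K₁ K₂ : Set (Fin N → ℝ)) (M : ℝ), IsCompact K₁ ∧ IsCompact K₂ ∧ 0 ≤ M ∧
      (∀ x ξ, ‖k x ξ‖ ≤ M) ∧ (∀ x ξ, x ∉ K₁ → k x ξ = 0) ∧ (∀ x ξ, ξ ∉ K₂ → k x ξ = 0) := by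
  obtain ⟨M, hM⟩ := hk.bounded_above_of_compact_support hkc
  refine ⟨_, _, M, hkc.image continuous_fst, hkc.image continuous_snd,
    (norm_nonneg _).trans (hM 0), fun x ξ => hM (x, ξ), fun x ξ hx => ?_, fun x ξ hξ => ?_⟩
  · by_contra h
    exact hx ⟨(x, ξ), subset_tsupport _ h, rfl⟩
  · by_contra h
    exact hξ ⟨(x, ξ), subset_tsupport _ h, rfl⟩

theorem integrable_kernel_mul {k : (Fin N → ℝ) → (Fin N → ℝ) → ℂ}
    (hk : Continuous (fun p : (Fin N → ℝ) × (Fin N → ℝ) => k p.1 p.2))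
    (hkc : HasCompactSupport (fun p : (Fin N → ℝ) × (Fin N → ℝ) => k p.1 p.2))
    {h : (Fin N → ℝ) → ℂ} (hh : LocallyIntegrable h) :
    Integrable (fun p : (Fin N → ℝ) × (Fin N → ℝ) => k p.1 p.2 * h p.2)
      (volume.prod volume) := by
  obtain ⟨K₁, K₂, M, hK₁, hK₂, -, hM, h₁, h₂⟩ := exists_kernel_bound hk hkc
  have i1 : Integrable (K₁.indicator (fun _ => (1 : ℂ))) :=
    (integrable_indicator_iff hK₁.measurableSet).2 (integrableOn_const hK₁.measure_lt_top.ne)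
  have i2 : Integrable (K₂.indicator h) :=
    (integrable_indicator_iff hK₂.measurableSet).2 (hh.integrableOn_isCompact hK₂)
  refine ((i1.mul_prod i2).bdd_mul (c := M) hk.aestronglyMeasurable
    (.of_forall fun p => hM p.1 p.2)).congr (.of_forall fun p => ?_)
  by_cases hx : p.1 ∈ K₁ <;> by_cases hξ : p.2 ∈ K₂ <;>
    simp [hx, hξ, h₁, h₂]

theorem memLp_kernel_left {k : (Fin N → ℝ) → (Fin N → ℝ) → ℂ}
    (hk : Continuous (fun p : (Fin N → ℝ) × (Fin N → ℝ) => k p.1 p.2))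
    (hkc : HasCompactSupport (fun p : (Fin N → ℝ) × (Fin N → ℝ) => k p.1 p.2))
    (ξ : Fin N → ℝ) : MemLp (fun x => k x ξ) 2 volume := by
  obtain ⟨K₁, K₂, M, hK₁, hK₂, -, hM, h₁, h₂⟩ := exists_kernel_bound hk hkc
  refine Continuous.memLp_of_hasCompactSupport (hk.comp (.prodMk_left ξ)) ?_
  exact HasCompactSupport.intro hK₁ fun x hx => h₁ x ξ hx

theorem continuous_toLp_kernel {k : (Fin N → ℝ) → (Fin N → ℝ) → ℂ}
    (hk : Continuous (fun p : (Fin N → ℝ) × (Fin N → ℝ) => k p.1 p.2))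
    (hkc : HasCompactSupport (fun p : (Fin N → ℝ) × (Fin N → ℝ) => k p.1 p.2)) :
    Continuous (fun ξ => (memLp_kernel_left hk hkc ξ).toLp) := by
  obtain ⟨K₁, K₂, M, hK₁, hK₂, -, hM, h₁, h₂⟩ := exists_kernel_bound hk hkc
  have huc := hkc.uniformContinuous_of_continuous hk
  rw [Metric.uniformContinuous_iff] at huc
  rw [Metric.continuous_iff]
  intro ξ₀ ε hε
  set v : ℝ := (volume K₁).toReal ^ (1 / 2 : ℝ) with hv
  have hv0 : 0 ≤ v := by positivity
  obtain ⟨d, hd, hd'⟩ := huc (ε / (v + 1)) (by positivity)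
  refine ⟨d, hd, fun ξ hξ => ?_⟩
  rw [dist_eq_norm, ← MemLp.toLp_sub, Lp.norm_toLp]
  have hle : eLpNorm ((fun x => k x ξ) - fun x => k x ξ₀) 2 volume
      ≤ eLpNorm (K₁.indicator fun _ => ε / (v + 1)) 2 volume := by
    refine eLpNorm_mono_real fun x => ?_
    by_cases hx : x ∈ K₁
    · have := hd' (a := (x, ξ)) (b := (x, ξ₀)) (by simpa [Prod.dist_eq, hd] using hξ)
      rw [dist_eq_norm] at this
      simpa [hx] using this.le
    · simp [hx, h₁]
  have hpos : 0 ≤ ε / (v + 1) := by positivity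
  rw [eLpNorm_indicator_const hK₁.measurableSet (by norm_num) (by norm_num)] at hle
  refine (ENNReal.toReal_mono ?_ hle).trans_lt ?_
  · exact ENNReal.mul_ne_top (by simp)
      (ENNReal.rpow_ne_top_of_nonneg (by simp) hK₁.measure_lt_top.ne)
  · rw [ENNReal.toReal_mul, ← ENNReal.toReal_rpow]
    simp only [toReal_enorm, Real.norm_eq_abs, abs_of_nonneg hpos, ENNReal.toReal_ofNat]
    rw [← hv, div_mul_eq_mul_div, div_lt_iff₀ (by positivity)]
    nlinarith

/-- Pairing with a square integrable Hilbert-space valued function is a compact operator. -/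
theorem isCompactOperator_lpPairing {α H : Type*} [MeasurableSpace α] {μ : Measure α}
    [NormedAddCommGroup H] [InnerProductSpace ℂ H] [CompleteSpace H] (κ : Lp H 2 μ) :
    IsCompactOperator ((ContinuousLinearMap.lsmul ℂ ℂ (E := H)).flip.lpPairing μ 2 2 κ) := by
  refine Lp.induction (p := 2) (by norm_num) (fun κ : Lp H 2 μ =>
    IsCompactOperator ((ContinuousLinearMap.lsmul ℂ ℂ (E := H)).flip.lpPairing μ 2 2 κ))
    ?_ ?_ ?_ κ
  · intro c s hs hμs
    have e : (ContinuousLinearMap.lsmul ℂ ℂ (E := H)).flip.lpPairing μ 2 2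
        (Lp.simpleFunc.indicatorConst 2 hs hμs.ne c : Lp H 2 μ)
        = (ContinuousLinearMap.toSpanSingleton ℂ c).comp
          (innerSL ℂ (indicatorConstLp 2 hs hμs.ne (1 : ℂ))) := by
      ext1 h
      rw [ContinuousLinearMap.lpPairing_eq_integral, ContinuousLinearMap.comp_apply,
        innerSL_apply_apply, L2.inner_indicatorConstLp_one,
        ContinuousLinearMap.toSpanSingleton_apply, ← integral_smul_const,
        ← integral_indicator hs]
      refine integral_congr_ae ?_
      rw [Lp.simpleFunc.coe_indicatorConst]
      filter_upwards [indicatorConstLp_coeFn (p := 2) (hs := hs) (hμs := hμs.ne) (c := c)]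
        with x hx
      rw [hx]
      by_cases hxs : x ∈ s <;> simp [hxs]
    rw [e]
    have hc : IsCompactOperator (innerSL ℂ (indicatorConstLp 2 hs hμs.ne (1 : ℂ))) :=
      isCompactOperator_of_locallyCompactSpace_dom _
    exact hc.clm_comp (ContinuousLinearMap.toSpanSingleton ℂ c)
  · intro f g hf hg _ h1 h2
    rw [map_add]
    exact h1.add h2
  · exact isClosed_setOfPred_isCompactOperator.preimage
      ((ContinuousLinearMap.lsmul ℂ ℂ (E := H)).flip.lpPairing μ 2 2).continuous

theorem exists_kernel_operator {k : (Fin N → ℝ) → (Fin N → ℝ) → ℂ}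
    (hk : Continuous (fun p : (Fin N → ℝ) × (Fin N → ℝ) => k p.1 p.2))
    (hkc : HasCompactSupport (fun p : (Fin N → ℝ) × (Fin N → ℝ) => k p.1 p.2)) :
    ∃ T : Lp ℂ 2 (volume : Measure (Fin N → ℝ)) →L[ℂ] Lp ℂ 2 (volume : Measure (Fin N → ℝ)),
      IsCompactOperator T ∧ ∀ h, ⇑(T h) =ᵐ[volume] fun x => ∫ ξ, k x ξ * h ξ := by
  obtain ⟨K₁, K₂, M, hK₁, hK₂, -, hM, h₁, h₂⟩ := exists_kernel_bound hk hkc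
  have hκ : MemLp (fun ξ => (memLp_kernel_left hk hkc ξ).toLp) 2 volume := by
    refine (continuous_toLp_kernel hk hkc).memLp_of_hasCompactSupport ?_
    refine HasCompactSupport.intro hK₂ fun ξ hξ => ?_
    rw [← norm_eq_zero, Lp.norm_toLp]
    have : (fun x => k x ξ) = 0 := funext fun x => h₂ x ξ hξ
    simp [this]
  refine ⟨_, isCompactOperator_lpPairing hκ.toLp, fun h => ?_⟩
  have hloc : LocallyIntegrable (h : (Fin N → ℝ) → ℂ) :=
    (Lp.memLp h).locallyIntegrable (by norm_num)
  have hInt := integrable_kernel_mul hk hkc hloc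
  refine ae_eq_of_forall_setIntegral_eq_of_sigmaFinite
    (fun s hs hμs => ?_) (fun s hs hμs => hInt.integral_prod_left.integrableOn)
    (fun s hs hμs => ?_)
  · exact integrableOn_Lp_of_measure_ne_top _ (by norm_num) hμs.ne
  · rw [← L2.inner_indicatorConstLp_one hs hμs.ne, ← innerSL_apply_apply ℂ,
      ContinuousLinearMap.lpPairing_eq_integral]
    have hcongr : ∀ᵐ ξ : Fin N → ℝ, (ContinuousLinearMap.lsmul ℂ ℂ).flip (hκ.toLp _ ξ) (h ξ)
        = h ξ • (memLp_kernel_left hk hkc ξ).toLp := by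
      filter_upwards [hκ.coeFn_toLp] with ξ hξ
      rw [hξ]
      rfl
    refine (congrArg _ (integral_congr_ae hcongr)).trans ?_
    rw [← ContinuousLinearMap.integral_comp_comm]
    · rw [integral_integral_swap (f := fun x ξ => k x ξ * h ξ)]
      · refine integral_congr_ae (.of_forall fun ξ => ?_)
        dsimp only
        rw [map_smul, innerSL_apply_apply, L2.inner_indicatorConstLp_one hs hμs.ne,
          integral_mul_const, smul_eq_mul, mul_comm]
        congr 1
        exact setIntegral_congr_ae hs ((memLp_kernel_left hk hkc ξ).coeFn_toLp.mono
          fun x hx _ => hx)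
      · have : (volume.restrict s).prod (volume : Measure (Fin N → ℝ))
            = (volume.prod volume).restrict (s ×ˢ Set.univ) := by
          rw [← Measure.prod_restrict, Measure.restrict_univ]
        rw [this]
        exact hInt.integrableOn
    · exact memLp_one_iff_integrable.1 (MemLp.smul (p := 2) (q := 2) (r := 1) hκ (Lp.memLp h))

end KernelOperator

/-! ### Windows and windowed Fourier transforms -/

section Window

variable {N : ℕ}

/-- The oscillating factor `e^{2πi x·ξ}`. -/
noncomputable def osc (x ξ : Fin N → ℝ) : ℂ :=
  Complex.exp (2 * (Real.pi : ℂ) * Complex.I * (dotProd x ξ : ℂ))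

/-- The window `∏_{k ∈ S} (1 + 2πi l z_k)⁻¹`, a product over a list of coordinates. -/
noncomputable def window (l : ℝ) (S : List (Fin N)) (z : Fin N → ℝ) : ℂ :=
  (S.map fun k => (1 + 2 * (Real.pi : ℂ) * Complex.I * l * (z k : ℂ))⁻¹).prod

/-- The windowed Fourier transform of `f` with window `window l S`. -/
noncomputable def windowedFourier (l : ℝ) (S : List (Fin N)) (f : (Fin N → ℝ) → ℂ)
    (x ξ : Fin N → ℝ) : ℂ :=
  fourierT (fun y => window l S (x - y) * f y) ξ

theorem dotProd_comm (x ξ : Fin N → ℝ) : dotProd x ξ = dotProd ξ x := by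
  simp [dotProd, mul_comm]

theorem osc_comm (x ξ : Fin N → ℝ) : osc x ξ = osc ξ x := by
  rw [osc, dotProd_comm, osc]

theorem norm_osc (x ξ : Fin N → ℝ) : ‖osc x ξ‖ = 1 := by
  have : osc x ξ = Complex.exp ((2 * Real.pi * dotProd x ξ : ℝ) * Complex.I) := by
    rw [osc]; congr 1; push_cast; ring
  rw [this, Complex.norm_exp_ofReal_mul_I]

theorem continuous_osc : Continuous fun p : (Fin N → ℝ) × (Fin N → ℝ) => osc p.1 p.2 := by
  unfold osc dotProd
  fun_prop

theorem osc_neg_eq (x ξ : Fin N → ℝ) :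
    Complex.exp (-(2 * (Real.pi : ℂ) * Complex.I * (dotProd x ξ : ℂ))) = osc (-x) ξ := by
  rw [osc]; congr 1; simp [dotProd]

theorem osc_sub (x y ξ : Fin N → ℝ) : osc (x - y) ξ = osc x ξ * osc (-y) ξ := by
  rw [osc, osc, osc, ← Complex.exp_add]; congr 1
  simp only [dotProd, Pi.sub_apply, Pi.neg_apply, sub_mul, neg_mul, Finset.sum_sub_distrib,
    Finset.sum_neg_distrib]
  push_cast; ring

theorem hasFDerivAt_osc (z ξ : Fin N → ℝ) :
    HasFDerivAt (osc z) (osc z ξ • (2 * (Real.pi : ℂ) * Complex.I) •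
      ∑ i, (z i : ℂ) • Complex.ofRealCLM.comp (ContinuousLinearMap.proj (R := ℝ) i)) ξ := by
  have h : HasFDerivAt (fun ξ : Fin N → ℝ => ∑ i, (z i : ℂ) *
      Complex.ofRealCLM (ContinuousLinearMap.proj (R := ℝ) (φ := fun _ => ℝ) i ξ))
      (∑ i, (z i : ℂ) • Complex.ofRealCLM.comp (ContinuousLinearMap.proj (R := ℝ) i)) ξ :=
    HasFDerivAt.fun_sum fun i _ => ((Complex.ofRealCLM.comp
      (ContinuousLinearMap.proj (R := ℝ) (φ := fun _ => ℝ) i)).hasFDerivAt).const_mul _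
  have h2 := (h.const_mul (2 * (Real.pi : ℂ) * Complex.I)).cexp
  have e : (osc z) = fun ξ : Fin N → ℝ => Complex.exp (2 * (Real.pi : ℂ) * Complex.I *
      ∑ i, (z i : ℂ) *
      Complex.ofRealCLM (ContinuousLinearMap.proj (R := ℝ) (φ := fun _ => ℝ) i ξ)) := by
    ext ξ
    simp [osc, dotProd]
  rw [e]
  exact h2

theorem fderiv_osc (z ξ : Fin N → ℝ) (k : Fin N) :
    fderiv ℝ (osc z) ξ (Pi.single k 1)
      = 2 * (Real.pi : ℂ) * Complex.I * (z k : ℂ) * osc z ξ := by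
  rw [(hasFDerivAt_osc z ξ).fderiv]
  simp only [smul_apply, sum_apply,
    ContinuousLinearMap.comp_apply, ContinuousLinearMap.proj_apply, smul_eq_mul]
  rw [Finset.sum_eq_single k]
  · simp; ring
  · intro i _ hi; simp [hi]
  · simp

theorem normSq_resolvent (l t : ℝ) :
    ‖(1 + 2 * (Real.pi : ℂ) * Complex.I * l * (t : ℂ))‖ ^ 2 = 1 + (2 * Real.pi * l * t) ^ 2 := by
  have : (1 + 2 * (Real.pi : ℂ) * Complex.I * l * (t : ℂ))
      = ((1 : ℝ) : ℂ) + ((2 * Real.pi * l * t : ℝ) : ℂ) * Complex.I := by push_cast; ring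
  rw [this, ← Complex.normSq_eq_norm_sq, Complex.normSq_add_mul_I]
  ring

theorem one_le_norm_resolvent (l t : ℝ) :
    1 ≤ ‖(1 + 2 * (Real.pi : ℂ) * Complex.I * l * (t : ℂ))‖ := by
  have := normSq_resolvent l t
  nlinarith [norm_nonneg (1 + 2 * (Real.pi : ℂ) * Complex.I * l * (t : ℂ)),
    sq_nonneg (2 * Real.pi * l * t)]

theorem resolvent_ne_zero (l t : ℝ) :
    (1 + 2 * (Real.pi : ℂ) * Complex.I * l * (t : ℂ)) ≠ 0 := fun h => by
  have := one_le_norm_resolvent l t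
  rw [h, norm_zero] at this
  linarith

theorem norm_resolvent_inv_le (l t : ℝ) :
    ‖(1 + 2 * (Real.pi : ℂ) * Complex.I * l * (t : ℂ))⁻¹‖ ≤ 1 := by
  rw [norm_inv]
  exact inv_le_one_of_one_le₀ (one_le_norm_resolvent l t)

theorem window_cons (l : ℝ) (k : Fin N) (S : List (Fin N)) (z : Fin N → ℝ) :
    window l (k :: S) z
      = (1 + 2 * (Real.pi : ℂ) * Complex.I * l * (z k : ℂ))⁻¹ * window l S z := by
  simp [window]

theorem resolvent_mul_window_cons (l : ℝ) (k : Fin N) (S : List (Fin N)) (z : Fin N → ℝ) :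
    (1 + 2 * (Real.pi : ℂ) * Complex.I * l * (z k : ℂ)) * window l (k :: S) z
      = window l S z := by
  rw [window_cons, mul_inv_cancel_left₀ (resolvent_ne_zero l (z k))]

theorem norm_window_le_one (l : ℝ) (S : List (Fin N)) (z : Fin N → ℝ) :
    ‖window l S z‖ ≤ 1 := by
  induction S with
  | nil => simp [window]
  | cons k S ih =>
    rw [window_cons, norm_mul]
    exact mul_le_one₀ (norm_resolvent_inv_le l (z k)) (norm_nonneg _) ih

theorem norm_window_le_prod (l : ℝ) (S : List (Fin N)) (z : Fin N → ℝ) (s : Finset (Fin N))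
    (hs : ∀ k ∈ s, k ∈ S) :
    ‖window l S z‖
      ≤ ∏ k ∈ s, ‖(1 + 2 * (Real.pi : ℂ) * Complex.I * l * (z k : ℂ))⁻¹‖ := by
  induction S generalizing s with
  | nil =>
    have : s = ∅ := Finset.eq_empty_of_forall_notMem fun k hk => by simpa using hs k hk
    simp [this, window]
  | cons j S ih =>
    rw [window_cons, norm_mul]
    by_cases hj : j ∈ s
    · rw [← Finset.mul_prod_erase s _ hj]
      refine mul_le_mul_of_nonneg_left (ih _ fun k hk => ?_) (norm_nonneg _)
      rw [Finset.mem_erase] at hk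
      simpa [hk.1] using hs k hk.2
    · refine (mul_le_of_le_one_left (norm_nonneg _) (norm_resolvent_inv_le l (z j))).trans
        (ih _ fun k hk => ?_)
      have hkj : k ≠ j := fun h => hj (h ▸ hk)
      simpa [hkj] using hs k hk

theorem hasFDerivAt_window (l : ℝ) (S : List (Fin N)) (z : Fin N → ℝ) :
    HasFDerivAt (window l S) (window l S z • (S.map fun j =>
      (-(2 * (Real.pi : ℂ) * Complex.I * l *
        (1 + 2 * (Real.pi : ℂ) * Complex.I * l * (z j : ℂ))⁻¹)) •
        Complex.ofRealCLM.comp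
          (ContinuousLinearMap.proj (R := ℝ) (φ := fun _ : Fin N => ℝ) j)).sum) z := by
  induction S with
  | nil =>
    have : (window l ([] : List (Fin N))) = fun _ => (1 : ℂ) := by ext; simp [window]
    rw [this]
    simpa using hasFDerivAt_const (1 : ℂ) z
  | cons k S ih =>
    have e : window l (k :: S) = fun z => (1 + 2 * (Real.pi : ℂ) * Complex.I * l *
        (Complex.ofRealCLM.comp (ContinuousLinearMap.proj (R := ℝ) (φ := fun _ : Fin N => ℝ) k))
          z)⁻¹ * window l S z := by
      ext z; rw [window_cons]; rfl
    have hr : HasFDerivAt (fun z : Fin N → ℝ => 1 + 2 * (Real.pi : ℂ) * Complex.I * l *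
        (Complex.ofRealCLM.comp (ContinuousLinearMap.proj (R := ℝ) (φ := fun _ : Fin N => ℝ) k))
          z) _ z :=
      (((Complex.ofRealCLM.comp (ContinuousLinearMap.proj (R := ℝ) (φ := fun _ : Fin N => ℝ)
        k)).hasFDerivAt).const_mul (2 * (Real.pi : ℂ) * Complex.I * l)).const_add 1
    have hne := resolvent_ne_zero l (z k)
    have hri := (hasDerivAt_inv hne).comp_hasFDerivAt z hr
    have := hri.mul ih
    rw [e]
    refine this.congr_fderiv ?_
    ext v
    simp only [List.map_cons, List.sum_cons, add_apply,
      smul_apply, ContinuousLinearMap.comp_apply,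
      ContinuousLinearMap.proj_apply, Complex.ofRealCLM_apply, smul_eq_mul, Function.comp_apply]
    field_simp
    ring

theorem fderiv_window_single (l : ℝ) (S : List (Fin N)) (z : Fin N → ℝ) (k : Fin N) :
    fderiv ℝ (window l S) z (Pi.single k 1)
      = -(2 * (Real.pi : ℂ) * Complex.I * l * S.count k) * window l (k :: S) z := by
  rw [(hasFDerivAt_window l S z).fderiv, window_cons, smul_apply]
  have h : ∀ L : List (Fin N), (L.map fun j =>
      (-(2 * (Real.pi : ℂ) * Complex.I * l *
        (1 + 2 * (Real.pi : ℂ) * Complex.I * l * (z j : ℂ))⁻¹)) •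
        Complex.ofRealCLM.comp
          (ContinuousLinearMap.proj (R := ℝ) (φ := fun _ : Fin N => ℝ) j)).sum (Pi.single k 1)
      = -(2 * (Real.pi : ℂ) * Complex.I * l * L.count k) *
        (1 + 2 * (Real.pi : ℂ) * Complex.I * l * (z k : ℂ))⁻¹ := by
    intro L
    induction L with
    | nil => simp
    | cons j L ih =>
      rw [List.map_cons, List.sum_cons, add_apply, ih, List.count_cons]
      by_cases hj : j = k
      · subst hj
        simp
        ring
      · simp [hj]
  rw [h, smul_eq_mul]
  ring

theorem continuous_window (l : ℝ) (S : List (Fin N)) : Continuous (window l S) :=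
  continuous_iff_continuousAt.2 fun z => (hasFDerivAt_window l S z).continuousAt

theorem exists_norm_fderiv_window_le (l : ℝ) (S : List (Fin N)) :
    ∃ B, ∀ z, ‖fderiv ℝ (window l S) z‖ ≤ B := by
  refine ⟨∑ k, ‖2 * (Real.pi : ℂ) * Complex.I * l * S.count k‖, fun z =>
    ContinuousLinearMap.opNorm_le_bound _ (by positivity) fun v => ?_⟩
  have hv : v = ∑ k, v k • (Pi.single k 1 : Fin N → ℝ) := by
    ext j; simp [Finset.sum_apply, Pi.single_apply]
  conv_lhs => rw [hv]
  rw [map_sum, Finset.sum_mul]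
  refine (norm_sum_le _ _).trans (Finset.sum_le_sum fun k _ => ?_)
  rw [map_smul, fderiv_window_single, norm_smul, norm_mul, norm_neg, mul_comm]
  refine mul_le_mul ?_ (norm_le_pi_norm v k) (norm_nonneg _) (norm_nonneg _)
  exact mul_le_of_le_one_right (norm_nonneg _) (norm_window_le_one _ _ _)

theorem continuous_fderiv_window (l : ℝ) (S : List (Fin N)) :
    Continuous (fderiv ℝ (window l S)) := by
  have : fderiv ℝ (window l S) = _ := funext fun z => (hasFDerivAt_window l S z).fderiv
  rw [this]
  refine (continuous_window l S).smul ?_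
  refine continuous_list_sum (l := S) (f := fun j (z : Fin N → ℝ) =>
      (-(2 * (Real.pi : ℂ) * Complex.I * l *
        (1 + 2 * (Real.pi : ℂ) * Complex.I * l * (z j : ℂ))⁻¹)) •
        Complex.ofRealCLM.comp
          (ContinuousLinearMap.proj (R := ℝ) (φ := fun _ : Fin N => ℝ) j)) fun j _ => ?_
  have hi : Continuous fun z : Fin N → ℝ =>
      (1 + 2 * (Real.pi : ℂ) * Complex.I * l * (z j : ℂ))⁻¹ :=
    Continuous.inv₀ (by fun_prop) fun z => resolvent_ne_zero l (z j)
  exact ((continuous_const.mul hi).neg).smul continuous_const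

/-- The `L²` norm of a window containing every coordinate. -/
theorem lintegral_window_sq_le {l : ℝ} (hl : 0 < l) (S : List (Fin N)) (hS : ∀ k, k ∈ S) :
    ∫⁻ z, ‖window l S z‖ₑ ^ 2 ≤ ENNReal.ofReal ((1 / (2 * l)) ^ N) := by
  have h1 : ∀ z : Fin N → ℝ, ‖window l S z‖ ^ 2 ≤ ∏ k, (1 + (2 * Real.pi * l * z k) ^ 2)⁻¹ := by
    intro z
    have := norm_window_le_prod l S z Finset.univ fun k _ => hS k
    refine (pow_le_pow_left₀ (norm_nonneg _) this 2).trans_eq ?_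
    rw [← Finset.prod_pow]
    refine Finset.prod_congr rfl fun k _ => ?_
    rw [norm_inv, inv_pow, normSq_resolvent]
  have h2 : Integrable fun t : ℝ => (1 + (2 * Real.pi * l * t) ^ 2)⁻¹ :=
    integrable_inv_one_add_sq.comp_mul_left' (by positivity)
  have h3 : ∫ t : ℝ, (1 + (2 * Real.pi * l * t) ^ 2)⁻¹ = 1 / (2 * l) := by
    rw [Measure.integral_comp_mul_left (fun t : ℝ => (1 + t ^ 2)⁻¹), integral_univ_inv_one_add_sq,
      abs_of_pos (by positivity), smul_eq_mul]
    field_simp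
  have h4 : Integrable fun z : Fin N → ℝ => ∏ k, (1 + (2 * Real.pi * l * z k) ^ 2)⁻¹ :=
    Integrable.fintype_prod (f := fun (_ : Fin N) t => (1 + (2 * Real.pi * l * t) ^ 2)⁻¹)
      fun _ => h2
  calc ∫⁻ z, ‖window l S z‖ₑ ^ 2
      ≤ ∫⁻ z : Fin N → ℝ, ENNReal.ofReal (∏ k, (1 + (2 * Real.pi * l * z k) ^ 2)⁻¹) := by
        refine lintegral_mono fun z => ?_
        rw [← ofReal_norm, ← ENNReal.ofReal_pow (norm_nonneg _)]
        exact ENNReal.ofReal_le_ofReal (h1 z)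
    _ = ENNReal.ofReal (∫ z : Fin N → ℝ, ∏ k, (1 + (2 * Real.pi * l * z k) ^ 2)⁻¹) :=
        (ofReal_integral_eq_lintegral_ofReal h4
          (.of_forall fun z => Finset.prod_nonneg fun k _ => by positivity)).symm
    _ = ENNReal.ofReal ((1 / (2 * l)) ^ N) := by
        rw [integral_fintype_prod_volume_eq_pow (fun t : ℝ => (1 + (2 * Real.pi * l * t) ^ 2)⁻¹),
          h3, Fintype.card_fin]

end Window

section WindowedFourier

variable {N : ℕ}

theorem windowedFourier_eq (l : ℝ) (S : List (Fin N)) (f : (Fin N → ℝ) → ℂ) (x ξ : Fin N → ℝ) :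
    windowedFourier l S f x ξ = ∫ y, osc (-y) ξ * (window l S (x - y) * f y) := by
  simp only [windowedFourier, fourierT, osc_neg_eq]

theorem windowedFourier_nil (l : ℝ) (f : (Fin N → ℝ) → ℂ) (x ξ : Fin N → ℝ) :
    windowedFourier l [] f x ξ = fourierT f ξ := by
  simp [windowedFourier, window]

theorem continuous_osc_left (ξ : Fin N → ℝ) : Continuous fun x => osc x ξ :=
  continuous_osc.comp (.prodMk_left ξ)

theorem continuous_osc_right (x : Fin N → ℝ) : Continuous (osc x) :=
  continuous_osc.comp (.prodMk_right x)

theorem integrable_window_mul (l : ℝ) (S : List (Fin N)) {f : (Fin N → ℝ) → ℂ}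
    (hf : Integrable f) (x : Fin N → ℝ) : Integrable fun y => window l S (x - y) * f y :=
  hf.bdd_mul (c := 1) ((continuous_window l S).comp (by fun_prop)).aestronglyMeasurable
    (.of_forall fun y => norm_window_le_one l S (x - y))

theorem memLp_window_mul (l : ℝ) (S : List (Fin N)) {f : (Fin N → ℝ) → ℂ}
    (hf : MemLp f 2) (x : Fin N → ℝ) : MemLp (fun y => window l S (x - y) * f y) 2 := by
  refine hf.of_le ((((continuous_window l S).comp
    (by fun_prop : Continuous fun y => x - y)).aestronglyMeasurable).mul hf.1)
    (.of_forall fun y => ?_)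
  rw [norm_mul]
  exact mul_le_of_le_one_left (norm_nonneg _) (norm_window_le_one l S (x - y))

theorem continuous_windowedFourier (l : ℝ) (S : List (Fin N)) {f : (Fin N → ℝ) → ℂ}
    (hf : Integrable f) :
    Continuous fun p : (Fin N → ℝ) × (Fin N → ℝ) => windowedFourier l S f p.1 p.2 := by
  simp only [windowedFourier_eq]
  refine continuous_of_dominated (bound := fun y => ‖f y‖) (fun p => ?_) (fun p => ?_) hf.norm ?_
  · exact ((continuous_osc_left p.2).comp continuous_neg).aestronglyMeasurable.mul
      (integrable_window_mul l S hf p.1).1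
  · refine .of_forall fun y => ?_
    rw [norm_mul, norm_mul, norm_osc, one_mul]
    exact mul_le_of_le_one_left (norm_nonneg _) (norm_window_le_one l S _)
  · refine .of_forall fun y => ?_
    refine ((continuous_osc_right (-y)).comp continuous_snd).mul (Continuous.mul ?_
      continuous_const)
    exact (continuous_window l S).comp (by fun_prop)

theorem hasFDerivAt_windowedFourier (l : ℝ) (S : List (Fin N)) {f : (Fin N → ℝ) → ℂ}
    (hf : Integrable f) (x ξ : Fin N → ℝ) :
    Integrable (fun y => (osc (-y) ξ * f y) • fderiv ℝ (window l S) (x - y)) ∧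
    HasFDerivAt (fun x => windowedFourier l S f x ξ)
      (∫ y, (osc (-y) ξ * f y) • fderiv ℝ (window l S) (x - y)) x := by
  obtain ⟨B, hB⟩ := exists_norm_fderiv_window_le l S
  have hosc := ((continuous_osc_left ξ).comp continuous_neg).aestronglyMeasurable
    (μ := (volume : Measure (Fin N → ℝ)))
  have hmeas : ∀ x, AEStronglyMeasurable
      (fun y => (osc (-y) ξ * f y) • fderiv ℝ (window l S) (x - y)) volume := fun x =>
    (hosc.mul hf.1).smul
      ((continuous_fderiv_window l S).comp (by fun_prop)).aestronglyMeasurable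
  have hbd : ∀ x y, ‖(osc (-y) ξ * f y) • fderiv ℝ (window l S) (x - y)‖ ≤ ‖f y‖ * B := by
    intro x y
    rw [norm_smul, norm_mul, norm_osc, one_mul]
    exact mul_le_mul_of_nonneg_left (hB _) (norm_nonneg _)
  refine ⟨(hf.norm.mul_const B).mono' (hmeas x) (.of_forall (hbd x)), ?_⟩
  simp only [windowedFourier_eq]
  refine hasFDerivAt_integral_of_dominated_of_fderiv_le
    (F' := fun x y => (osc (-y) ξ * f y) • fderiv ℝ (window l S) (x - y))
    (bound := fun y => ‖f y‖ * B) univ_mem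
    (.of_forall fun x => ?_) ?_ (hmeas x) (.of_forall fun y x _ => hbd x y) (hf.norm.mul_const B)
    (.of_forall fun y x _ => ?_)
  · exact hosc.mul (integrable_window_mul l S hf x).1
  · exact (integrable_window_mul l S hf x).bdd_mul (c := 1) hosc
      (.of_forall fun y => (norm_osc _ _).le)
  · have h := (hasFDerivAt_window l S (x - y)).differentiableAt.hasFDerivAt
    have h2 : HasFDerivAt (fun x => window l S (x - y)) (fderiv ℝ (window l S) (x - y)) x :=
      (HasFDerivAt.comp (f := fun x => x - y) x h ((hasFDerivAt_id x).sub_const y)).congr_fderiv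
        (by ext; simp)
    have := h2.const_mul (osc (-y) ξ * f y)
    refine this.congr_of_eventuallyEq (.of_forall fun x => ?_)
    simp only
    ring

theorem fderiv_windowedFourier_single (l : ℝ) (S : List (Fin N)) {f : (Fin N → ℝ) → ℂ}
    (hf : Integrable f) (x ξ : Fin N → ℝ) (k : Fin N) :
    fderiv ℝ (fun x => windowedFourier l S f x ξ) x (Pi.single k 1)
      = -(2 * (Real.pi : ℂ) * Complex.I * l * S.count k) * windowedFourier l (k :: S) f x ξ := by
  obtain ⟨h1, h2⟩ := hasFDerivAt_windowedFourier l S hf x ξ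
  rw [h2.fderiv, ContinuousLinearMap.integral_apply h1, windowedFourier_eq,
    ← integral_const_mul]
  refine integral_congr_ae (.of_forall fun y => ?_)
  simp only [smul_apply, fderiv_window_single, smul_eq_mul]
  ring

/-- Integration by parts against the oscillating factor. -/
theorem integral_sub_fderiv_mul_osc {c : (Fin N → ℝ) → ℂ} (hc : Differentiable ℝ c)
    (hcs : HasCompactSupport c) (k : Fin N)
    (hck : Continuous fun ξ => fderiv ℝ c ξ (Pi.single k 1)) (l : ℝ) (z : Fin N → ℝ) :
    ∫ ξ, (c ξ - l * fderiv ℝ c ξ (Pi.single k 1)) * osc z ξ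
      = (1 + 2 * (Real.pi : ℂ) * Complex.I * l * (z k : ℂ)) * ∫ ξ, c ξ * osc z ξ := by
  have hcs' : HasCompactSupport fun ξ => fderiv ℝ c ξ (Pi.single k 1) :=
    hcs.fderiv_apply (𝕜 := ℝ) (Pi.single k 1)
  have i1 : Integrable fun ξ => c ξ * osc z ξ :=
    (hc.continuous.mul (continuous_osc_right z)).integrable_of_hasCompactSupport hcs.mul_right
  have i2 : Integrable fun ξ => fderiv ℝ c ξ (Pi.single k 1) * osc z ξ :=
    (hck.mul (continuous_osc_right z)).integrable_of_hasCompactSupport hcs'.mul_right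
  have i3 : Integrable fun ξ => c ξ * fderiv ℝ (osc z) ξ (Pi.single k 1) := by
    simp only [fderiv_osc]
    refine (hc.continuous.mul (continuous_const.mul
      (continuous_osc_right z))).integrable_of_hasCompactSupport hcs.mul_right
  have h := integral_mul_fderiv_eq_neg_fderiv_mul_of_integrable i2 i3 i1
    (fun x _ => hc x) (fun x _ => (hasFDerivAt_osc z x).differentiableAt)
  simp only [fderiv_osc] at h
  have h' : ∫ ξ, c ξ * (2 * (Real.pi : ℂ) * Complex.I * (z k : ℂ) * osc z ξ)
      = 2 * (Real.pi : ℂ) * Complex.I * (z k : ℂ) * ∫ ξ, c ξ * osc z ξ := by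
    rw [← integral_const_mul]
    refine integral_congr_ae (.of_forall fun ξ => ?_)
    simp only; ring
  rw [h'] at h
  have e : ∀ ξ, (c ξ - l * fderiv ℝ c ξ (Pi.single k 1)) * osc z ξ
      = c ξ * osc z ξ - l * (fderiv ℝ c ξ (Pi.single k 1) * osc z ξ) := fun ξ => by ring
  simp only [e]
  rw [integral_sub i1 (i2.const_mul _), integral_const_mul]
  linear_combination (-(l : ℂ)) * h

theorem integral_mul_osc_mul_fourierT {c q : (Fin N → ℝ) → ℂ} (hc : Integrable c)
    (hq : Integrable q) (x : Fin N → ℝ) :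
    ∫ ξ, c ξ * osc x ξ * fourierT q ξ = ∫ y, (∫ ξ, c ξ * osc (x - y) ξ) * q y := by
  have e : ∀ ξ, c ξ * osc x ξ * fourierT q ξ = ∫ y, osc (x - y) ξ * (c ξ * q y) := by
    intro ξ
    rw [fourierT, ← integral_const_mul]
    refine integral_congr_ae (.of_forall fun y => ?_)
    simp only [osc_sub, osc_neg_eq]
    ring
  simp only [e]
  rw [integral_integral_swap]
  · refine integral_congr_ae (.of_forall fun y => ?_)
    simp only
    rw [← integral_mul_const]
    refine integral_congr_ae (.of_forall fun ξ => ?_)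
    simp only
    ring
  · refine (hc.mul_prod hq).bdd_mul (c := 1) (Continuous.aestronglyMeasurable ?_)
      (.of_forall fun p => (norm_osc _ _).le)
    exact continuous_osc.comp (by fun_prop : Continuous fun p : (Fin N → ℝ) × (Fin N → ℝ) =>
      (x - p.2, p.1))

/-- Trading a derivative of the amplitude for a factor of the window. -/
theorem integral_mul_osc_mul_windowedFourier {c : (Fin N → ℝ) → ℂ} (hc : Differentiable ℝ c)
    (hcs : HasCompactSupport c) (k : Fin N)
    (hck : Continuous fun ξ => fderiv ℝ c ξ (Pi.single k 1)) (l : ℝ) (S : List (Fin N))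
    {f : (Fin N → ℝ) → ℂ} (hf : Integrable f) (x : Fin N → ℝ) :
    ∫ ξ, c ξ * osc x ξ * windowedFourier l S f x ξ
      = ∫ ξ, (c ξ - l * fderiv ℝ c ξ (Pi.single k 1)) * osc x ξ *
          windowedFourier l (k :: S) f x ξ := by
  have i1 : Integrable c := hc.continuous.integrable_of_hasCompactSupport hcs
  have i2 : Integrable fun ξ => c ξ - l * fderiv ℝ c ξ (Pi.single k 1) :=
    i1.sub ((hck.integrable_of_hasCompactSupport
      (hcs.fderiv_apply (𝕜 := ℝ) (Pi.single k 1))).const_mul _)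
  simp only [windowedFourier]
  rw [integral_mul_osc_mul_fourierT i1 (integrable_window_mul l S hf x),
    integral_mul_osc_mul_fourierT i2 (integrable_window_mul l (k :: S) hf x)]
  refine integral_congr_ae (.of_forall fun y => ?_)
  simp only
  rw [integral_sub_fderiv_mul_osc hc hcs k hck, ← resolvent_mul_window_cons l k S (x - y)]
  ring

theorem lintegral_enorm_sq {α E : Type*} [MeasurableSpace α] {μ : Measure α}
    [NormedAddCommGroup E] (f : α → E) :
    ∫⁻ x, ‖f x‖ₑ ^ 2 ∂μ = eLpNorm f 2 μ ^ 2 := by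
  have := eLpNorm_nnreal_pow_eq_lintegral (f := f) (μ := μ) (p := 2) (by norm_num)
  simpa using this.symm

theorem lintegral_windowedFourier_sq_le {l : ℝ} (hl : 0 < l) {S : List (Fin N)}
    (hS : ∀ k, k ∈ S) {f : (Fin N → ℝ) → ℂ} (hf : Integrable f) (hf2 : MemLp f 2) :
    ∫⁻ x, ∫⁻ ξ, ‖windowedFourier l S f x ξ‖ₑ ^ 2
      ≤ ENNReal.ofReal ((1 / (2 * l)) ^ N) * eLpNorm f 2 volume ^ 2 := by
  have e : ∀ x, ∫⁻ ξ, ‖windowedFourier l S f x ξ‖ₑ ^ 2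
      = ∫⁻ y, ‖window l S (x - y)‖ₑ ^ 2 * ‖f y‖ₑ ^ 2 := by
    intro x
    rw [lintegral_enorm_sq]
    rw [show windowedFourier l S f x = fourierT (fun y => window l S (x - y) * f y) from rfl,
      eLpNorm_fourierT (integrable_window_mul l S hf x) (memLp_window_mul l S hf2 x),
      ← lintegral_enorm_sq]
    simp only [enorm_mul, mul_pow]
  simp only [e]
  have hw : Continuous fun p : (Fin N → ℝ) × (Fin N → ℝ) => window l S (p.1 - p.2) :=
    (continuous_window l S).comp (by fun_prop)
  rw [lintegral_lintegral_swap, ← lintegral_enorm_sq]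
  · rw [← lintegral_const_mul'' _ (hf.1.enorm.pow_const 2)]
    refine lintegral_mono fun y => ?_
    simp only
    rw [lintegral_mul_const' _ _ (by simp),
      lintegral_sub_right_eq_self (fun z => ‖window l S z‖ₑ ^ 2) y]
    gcongr
    exact lintegral_window_sq_le hl S hS
  · exact (hw.enorm.measurable.pow_const 2).aemeasurable.mul (hf.1.comp_snd.enorm.pow_const 2)

end WindowedFourier

section Oscillatory

variable {N : ℕ}

/-- A smooth compactly supported symbol. -/
structure IsTestSymbol (b : (Fin N → ℝ) → (Fin N → ℝ) → ℂ) : Prop where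
  smooth : ContDiff ℝ ∞ fun p : (Fin N → ℝ) × (Fin N → ℝ) => b p.1 p.2
  compact : HasCompactSupport fun p : (Fin N → ℝ) × (Fin N → ℝ) => b p.1 p.2

theorem pdX_eq {b : (Fin N → ℝ) → (Fin N → ℝ) → ℂ}
    (hb : ContDiff ℝ ∞ fun p : (Fin N → ℝ) × (Fin N → ℝ) => b p.1 p.2) (k : Fin N)
    (x θ : Fin N → ℝ) :
    pdX k b x θ = fderiv ℝ (fun p : (Fin N → ℝ) × (Fin N → ℝ) => b p.1 p.2) (x, θ)
      (Pi.single k 1, 0) := by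
  have h := (hb.differentiable (by simp) (x, θ)).hasFDerivAt.comp x
    (hasFDerivAt_prodMk_left (𝕜 := ℝ) x θ)
  rw [pdX]
  exact congrArg (fun T => T (Pi.single k 1)) h.fderiv

theorem pdTheta_eq {b : (Fin N → ℝ) → (Fin N → ℝ) → ℂ}
    (hb : ContDiff ℝ ∞ fun p : (Fin N → ℝ) × (Fin N → ℝ) => b p.1 p.2) (k : Fin N)
    (x θ : Fin N → ℝ) :
    pdTheta k b x θ = fderiv ℝ (fun p : (Fin N → ℝ) × (Fin N → ℝ) => b p.1 p.2) (x, θ)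
      (0, Pi.single k 1) := by
  have h := (hb.differentiable (by simp) (x, θ)).hasFDerivAt.comp θ
    (hasFDerivAt_prodMk_right (𝕜 := ℝ) x θ)
  rw [pdTheta]
  exact congrArg (fun T => T (Pi.single k 1)) h.fderiv

theorem contDiff_pdX {b : (Fin N → ℝ) → (Fin N → ℝ) → ℂ}
    (hb : ContDiff ℝ ∞ fun p : (Fin N → ℝ) × (Fin N → ℝ) => b p.1 p.2) (k : Fin N) :
    ContDiff ℝ ∞ fun p : (Fin N → ℝ) × (Fin N → ℝ) => pdX k b p.1 p.2 := by
  simp only [pdX_eq hb]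
  exact (hb.fderiv_right (m := ∞) (by simp)).clm_apply contDiff_const

theorem contDiff_pdTheta {b : (Fin N → ℝ) → (Fin N → ℝ) → ℂ}
    (hb : ContDiff ℝ ∞ fun p : (Fin N → ℝ) × (Fin N → ℝ) => b p.1 p.2) (k : Fin N) :
    ContDiff ℝ ∞ fun p : (Fin N → ℝ) × (Fin N → ℝ) => pdTheta k b p.1 p.2 := by
  simp only [pdTheta_eq hb]
  exact (hb.fderiv_right (m := ∞) (by simp)).clm_apply contDiff_const

theorem differentiable_slice_left {b : (Fin N → ℝ) → (Fin N → ℝ) → ℂ}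
    (hb : ContDiff ℝ ∞ fun p : (Fin N → ℝ) × (Fin N → ℝ) => b p.1 p.2) (θ : Fin N → ℝ) :
    Differentiable ℝ fun x => b x θ :=
  (hb.differentiable (by simp)).comp (differentiable_id.prodMk (differentiable_const θ))

theorem differentiable_slice_right {b : (Fin N → ℝ) → (Fin N → ℝ) → ℂ}
    (hb : ContDiff ℝ ∞ fun p : (Fin N → ℝ) × (Fin N → ℝ) => b p.1 p.2) (x : Fin N → ℝ) :
    Differentiable ℝ fun θ => b x θ :=
  (hb.differentiable (by simp)).comp ((differentiable_const x).prodMk differentiable_id)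

namespace IsTestSymbol

variable {b b' : (Fin N → ℝ) → (Fin N → ℝ) → ℂ}

theorem pdX (hb : IsTestSymbol b) (k : Fin N) : IsTestSymbol (pdX k b) where
  smooth := contDiff_pdX hb.smooth k
  compact := by
    simp only [pdX_eq hb.smooth]
    exact hb.compact.fderiv_apply (𝕜 := ℝ) _

theorem pdTheta (hb : IsTestSymbol b) (k : Fin N) : IsTestSymbol (pdTheta k b) where
  smooth := contDiff_pdTheta hb.smooth k
  compact := by
    simp only [pdTheta_eq hb.smooth]
    exact hb.compact.fderiv_apply (𝕜 := ℝ) _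

theorem sub_const_mul (hb : IsTestSymbol b) (hb' : IsTestSymbol b') (c : ℂ) :
    IsTestSymbol fun x θ => b x θ - c * b' x θ where
  smooth := hb.smooth.sub (contDiff_const.mul hb'.smooth)
  compact := by
    have h : HasCompactSupport fun p : (Fin N → ℝ) × (Fin N → ℝ) => -c * b' p.1 p.2 :=
      hb'.compact.mul_left
    simpa only [neg_mul, sub_eq_add_neg] using! hb.compact.add h

theorem compact_left (hb : IsTestSymbol b) (θ : Fin N → ℝ) :
    HasCompactSupport fun x => b x θ := by
  obtain ⟨K₁, K₂, M, hK₁, -, -, -, h₁, -⟩ := exists_kernel_bound hb.smooth.continuous hb.compact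
  exact HasCompactSupport.intro hK₁ fun x hx => h₁ x θ hx

theorem compact_right (hb : IsTestSymbol b) (x : Fin N → ℝ) :
    HasCompactSupport fun θ => b x θ := by
  obtain ⟨K₁, K₂, M, -, hK₂, -, -, -, h₂⟩ := exists_kernel_bound hb.smooth.continuous hb.compact
  exact HasCompactSupport.intro hK₂ fun θ hθ => h₂ x θ hθ

end IsTestSymbol

/-- The oscillatory sesquilinear form with amplitude `b`, tested on the windowed transforms of
`f` and `γ` at the reciprocal scales `l` and `l⁻¹`. -/
noncomputable def oscForm (l : ℝ) (b : (Fin N → ℝ) → (Fin N → ℝ) → ℂ) (S T : List (Fin N))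
    (f γ : (Fin N → ℝ) → ℂ) : ℂ :=
  ∫ p : (Fin N → ℝ) × (Fin N → ℝ), b p.1 p.2 * osc p.1 p.2 * windowedFourier l S f p.1 p.2 *
    windowedFourier l⁻¹ T γ p.2 p.1 ∂(volume.prod volume)

variable {b : (Fin N → ℝ) → (Fin N → ℝ) → ℂ} {f γ : (Fin N → ℝ) → ℂ}

theorem continuous_windowedFourier_swap (l : ℝ) (S : List (Fin N)) (hf : Integrable f) :
    Continuous fun p : (Fin N → ℝ) × (Fin N → ℝ) => windowedFourier l S f p.2 p.1 := by
  have h := (continuous_windowedFourier l S hf).comp continuous_swap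
  simpa only [Function.comp_def, Prod.fst_swap, Prod.snd_swap] using h

theorem integrable_oscForm (hb : IsTestSymbol b) (l : ℝ) (S T : List (Fin N))
    (hf : Integrable f) (hγ : Integrable γ) :
    Integrable (fun p : (Fin N → ℝ) × (Fin N → ℝ) => b p.1 p.2 * osc p.1 p.2 *
      windowedFourier l S f p.1 p.2 * windowedFourier l⁻¹ T γ p.2 p.1) (volume.prod volume) := by
  have h1 := (hb.smooth.continuous.mul continuous_osc).mul (continuous_windowedFourier l S hf)
  have h2 : Continuous fun p : (Fin N → ℝ) × (Fin N → ℝ) => windowedFourier l⁻¹ T γ p.2 p.1 :=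
    continuous_windowedFourier_swap l⁻¹ T hγ
  have c1 : HasCompactSupport fun p : (Fin N → ℝ) × (Fin N → ℝ) =>
      b p.1 p.2 * osc p.1 p.2 := hb.compact.mul_right
  have c2 : HasCompactSupport fun p : (Fin N → ℝ) × (Fin N → ℝ) =>
      b p.1 p.2 * osc p.1 p.2 * windowedFourier l S f p.1 p.2 := c1.mul_right
  exact (h1.mul h2).integrable_of_hasCompactSupport c2.mul_right

theorem oscForm_cons_left (hb : IsTestSymbol b) (l : ℝ) (S : List (Fin N)) (k : Fin N)
    (hf : Integrable f) (hγ : Integrable γ) :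
    oscForm l b S [] f γ
      = oscForm l (fun x θ => b x θ - l * pdTheta k b x θ) (k :: S) [] f γ := by
  have hb' := hb.sub_const_mul (hb.pdTheta k) l
  rw [oscForm, oscForm, integral_prod _ (integrable_oscForm hb l S [] hf hγ),
    integral_prod _ (integrable_oscForm hb' l (k :: S) [] hf hγ)]
  refine integral_congr_ae (.of_forall fun x => ?_)
  simp only [windowedFourier_nil]
  rw [integral_mul_const, integral_mul_const,
    integral_mul_osc_mul_windowedFourier (differentiable_slice_right hb.smooth x)
      (hb.compact_right x) k ?_ l S
      hf x]
  · rfl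
  · exact (hb.pdTheta k).smooth.continuous.comp (.prodMk_right x)

theorem oscForm_cons_right (hb : IsTestSymbol b) {l : ℝ} (hl : l ≠ 0) (S T : List (Fin N))
    (k : Fin N) (hf : Integrable f) (hγ : Integrable γ) :
    oscForm l b S T f γ
      = oscForm l (fun x θ => b x θ - (l⁻¹ : ℝ) * pdX k b x θ) S (k :: T) f γ
        + 2 * (Real.pi : ℂ) * Complex.I * S.count k * oscForm l b (k :: S) (k :: T) f γ := by
  have hb' := hb.sub_const_mul (hb.pdX k) (l⁻¹ : ℝ)
  have i1 := integrable_oscForm hb' l S (k :: T) hf hγ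
  have i2 := (integrable_oscForm hb l (k :: S) (k :: T) hf hγ).const_mul
    (2 * (Real.pi : ℂ) * Complex.I * S.count k)
  rw [oscForm, oscForm, oscForm, ← integral_const_mul, ← integral_add i1 i2,
    integral_prod_symm _ (integrable_oscForm hb l S T hf hγ), integral_prod_symm _ (by exact i1.add i2)]
  refine integral_congr_ae (.of_forall fun ξ => ?_)
  have hlC : (l : ℂ) ≠ 0 := by exact_mod_cast hl
  have hd : ∀ x, fderiv ℝ (fun x => b x ξ * windowedFourier l S f x ξ) x (Pi.single k 1)
      = pdX k b x ξ * windowedFourier l S f x ξ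
        + b x ξ * (-(2 * (Real.pi : ℂ) * Complex.I * l * S.count k) *
          windowedFourier l (k :: S) f x ξ) := by
    intro x
    rw [← fderiv_windowedFourier_single l S hf x ξ k,
      fderiv_fun_mul (differentiable_slice_left hb.smooth ξ x)
      (hasFDerivAt_windowedFourier l S hf x ξ).2.differentiableAt]
    simp only [add_apply, smul_apply, smul_eq_mul, pdX]
    ring
  have h := integral_mul_osc_mul_windowedFourier (l := l⁻¹) (S := T) (f := γ) (x := ξ)
    (c := fun x => b x ξ * windowedFourier l S f x ξ)
    (fun x => (differentiable_slice_left hb.smooth ξ x).mul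
      (hasFDerivAt_windowedFourier l S hf x ξ).2.differentiableAt)
    ((hb.compact_left ξ).mul_right) k ?_ hγ
  · simp only [hd] at h
    simp only
    calc _ = ∫ x, b x ξ * windowedFourier l S f x ξ * osc ξ x * windowedFourier l⁻¹ T γ ξ x := by
          refine integral_congr_ae (.of_forall fun x => ?_)
          simp only [osc_comm x ξ]
          ring
      _ = _ := by
          rw [h]
          refine integral_congr_ae (.of_forall fun x => ?_)
          simp only [osc_comm x ξ]
          push_cast
          field_simp
          ring
  · simp only [hd]
    have h1 := (hb.pdX k).smooth.continuous.comp (.prodMk_left ξ)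
    have h2 := (continuous_windowedFourier l S hf).comp (.prodMk_left ξ)
    have h3 := (continuous_windowedFourier l (k :: S) hf).comp (.prodMk_left ξ)
    have h4 := hb.smooth.continuous.comp (.prodMk_left ξ)
    exact (h1.mul h2).add (h4.mul (continuous_const.mul h3))

/-- The oscillatory form is bounded once both windows contain every coordinate. -/
theorem norm_oscForm_le {l : ℝ} (hl : 0 < l) {S T : List (Fin N)} (hS : ∀ k, k ∈ S)
    (hT : ∀ k, k ∈ T) (hf : Integrable f) (hf2 : MemLp f 2) (hγ : Integrable γ)
    (hγ2 : MemLp γ 2) {M : ℝ} (hM : 0 ≤ M) (hbM : ∀ x θ, ‖b x θ‖ ≤ M) :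
    ‖oscForm l b S T f γ‖ ≤ M * (eLpNorm f 2 volume).toReal * (eLpNorm γ 2 volume).toReal := by
  have hcf := continuous_windowedFourier l S hf
  have hcγ : Continuous fun p : (Fin N → ℝ) × (Fin N → ℝ) => windowedFourier l⁻¹ T γ p.2 p.1 :=
    continuous_windowedFourier_swap l⁻¹ T hγ
  have hff : ∫⁻ p : (Fin N → ℝ) × (Fin N → ℝ), ‖windowedFourier l S f p.1 p.2‖ₑ ^ (2 : ℝ)
      ∂(volume.prod volume) ≤ ENNReal.ofReal ((1 / (2 * l)) ^ N) * eLpNorm f 2 volume ^ 2 := by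
    simp only [ENNReal.rpow_two]
    rw [lintegral_prod _ (hcf.enorm.measurable.pow_const 2).aemeasurable]
    exact lintegral_windowedFourier_sq_le hl hS hf hf2
  have hγγ : ∫⁻ p : (Fin N → ℝ) × (Fin N → ℝ), ‖windowedFourier l⁻¹ T γ p.2 p.1‖ₑ ^ (2 : ℝ)
      ∂(volume.prod volume) ≤ ENNReal.ofReal ((1 / (2 * l⁻¹)) ^ N) * eLpNorm γ 2 volume ^ 2 := by
    simp only [ENNReal.rpow_two]
    rw [lintegral_prod_symm _ (hcγ.enorm.measurable.pow_const 2).aemeasurable]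
    exact lintegral_windowedFourier_sq_le (inv_pos.2 hl) hT hγ hγ2
  have hconst : ENNReal.ofReal ((1 / (2 * l)) ^ N) * ENNReal.ofReal ((1 / (2 * l⁻¹)) ^ N) ≤ 1 := by
    rw [← ENNReal.ofReal_mul (by positivity), ← mul_pow]
    refine ENNReal.ofReal_le_one.2 (pow_le_one₀ (by positivity) ?_)
    field_simp
    norm_num
  have key : ‖oscForm l b S T f γ‖ₑ
      ≤ ENNReal.ofReal M * (eLpNorm f 2 volume * eLpNorm γ 2 volume) := by
    calc ‖oscForm l b S T f γ‖ₑ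
        ≤ ∫⁻ p : (Fin N → ℝ) × (Fin N → ℝ), ENNReal.ofReal M *
            (‖windowedFourier l S f p.1 p.2‖ₑ * ‖windowedFourier l⁻¹ T γ p.2 p.1‖ₑ)
            ∂(volume.prod volume) := by
          refine (enorm_integral_le_lintegral_enorm _).trans (lintegral_mono fun p => ?_)
          rw [enorm_mul, enorm_mul, enorm_mul, ← ofReal_norm (osc _ _), norm_osc,
            ENNReal.ofReal_one, mul_one, mul_assoc, ← ofReal_norm (b _ _)]
          gcongr
          exact hbM _ _
      _ = ENNReal.ofReal M * ∫⁻ p : (Fin N → ℝ) × (Fin N → ℝ),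
            (‖windowedFourier l S f p.1 p.2‖ₑ * ‖windowedFourier l⁻¹ T γ p.2 p.1‖ₑ)
            ∂(volume.prod volume) := lintegral_const_mul' _ _ ENNReal.ofReal_ne_top
      _ ≤ ENNReal.ofReal M * (eLpNorm f 2 volume * eLpNorm γ 2 volume) := by
          gcongr
          refine (ENNReal.lintegral_mul_le_Lp_mul_Lq _ Real.HolderConjugate.two_two
            hcf.enorm.measurable.aemeasurable hcγ.enorm.measurable.aemeasurable).trans ?_
          refine (mul_le_mul' (ENNReal.rpow_le_rpow hff (by norm_num))
            (ENNReal.rpow_le_rpow hγγ (by norm_num))).trans ?_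
          rw [← ENNReal.mul_rpow_of_nonneg _ _ (by norm_num)]
          have : ENNReal.ofReal ((1 / (2 * l)) ^ N) * eLpNorm f 2 volume ^ 2 *
              (ENNReal.ofReal ((1 / (2 * l⁻¹)) ^ N) * eLpNorm γ 2 volume ^ 2)
              ≤ (eLpNorm f 2 volume * eLpNorm γ 2 volume) ^ (2 : ℝ) := by
            rw [ENNReal.rpow_two, mul_mul_mul_comm, ← mul_pow]
            exact mul_le_of_le_one_left' hconst
          refine (ENNReal.rpow_le_rpow this (by norm_num)).trans_eq ?_
          rw [← ENNReal.rpow_mul]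
          norm_num
  have := ENNReal.toReal_mono (ENNReal.mul_ne_top ENNReal.ofReal_ne_top
    (ENNReal.mul_ne_top hf2.2.ne hγ2.2.ne)) key
  rwa [toReal_enorm, ENNReal.toReal_mul, ENNReal.toReal_mul, ENNReal.toReal_ofReal hM,
    ← mul_assoc] at this

end Oscillatory

section Families

variable {N : ℕ}

theorem contDiff_foldr_pdX {b : (Fin N → ℝ) → (Fin N → ℝ) → ℂ}
    (hb : ContDiff ℝ ∞ fun p : (Fin N → ℝ) × (Fin N → ℝ) => b p.1 p.2) (L : List (Fin N)) :
    ContDiff ℝ ∞ fun p : (Fin N → ℝ) × (Fin N → ℝ) => L.foldr pdX b p.1 p.2 := by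
  induction L with
  | nil => exact hb
  | cons k L ih => exact contDiff_pdX ih k

theorem contDiff_foldr_pdTheta {b : (Fin N → ℝ) → (Fin N → ℝ) → ℂ}
    (hb : ContDiff ℝ ∞ fun p : (Fin N → ℝ) × (Fin N → ℝ) => b p.1 p.2) (L : List (Fin N)) :
    ContDiff ℝ ∞ fun p : (Fin N → ℝ) × (Fin N → ℝ) => L.foldr pdTheta b p.1 p.2 := by
  induction L with
  | nil => exact hb
  | cons k L ih => exact contDiff_pdTheta ih k

theorem foldr_pdX_add_const_mul {a b : (Fin N → ℝ) → (Fin N → ℝ) → ℂ}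
    (ha : ContDiff ℝ ∞ fun p : (Fin N → ℝ) × (Fin N → ℝ) => a p.1 p.2)
    (hb : ContDiff ℝ ∞ fun p : (Fin N → ℝ) × (Fin N → ℝ) => b p.1 p.2) (c : ℂ)
    (L : List (Fin N)) :
    L.foldr pdX (fun x θ => a x θ + c * b x θ)
      = fun x θ => L.foldr pdX a x θ + c * L.foldr pdX b x θ := by
  induction L with
  | nil => rfl
  | cons k L ih =>
    simp only [List.foldr_cons, ih]
    ext x θ
    have h1 := differentiable_slice_left (contDiff_foldr_pdX ha L) θ x
    have h2 := differentiable_slice_left (contDiff_foldr_pdX hb L) θ x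
    simp only [pdX]
    rw [fderiv_fun_add h1 (h2.const_mul c), fderiv_const_mul h2]
    simp

theorem foldr_pdTheta_add_const_mul {a b : (Fin N → ℝ) → (Fin N → ℝ) → ℂ}
    (ha : ContDiff ℝ ∞ fun p : (Fin N → ℝ) × (Fin N → ℝ) => a p.1 p.2)
    (hb : ContDiff ℝ ∞ fun p : (Fin N → ℝ) × (Fin N → ℝ) => b p.1 p.2) (c : ℂ)
    (L : List (Fin N)) :
    L.foldr pdTheta (fun x θ => a x θ + c * b x θ)
      = fun x θ => L.foldr pdTheta a x θ + c * L.foldr pdTheta b x θ := by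
  induction L with
  | nil => rfl
  | cons k L ih =>
    simp only [List.foldr_cons, ih]
    ext x θ
    have h1 := differentiable_slice_right (contDiff_foldr_pdTheta ha L) x θ
    have h2 := differentiable_slice_right (contDiff_foldr_pdTheta hb L) x θ
    simp only [pdTheta]
    rw [fderiv_fun_add h1 (h2.const_mul c), fderiv_const_mul h2]
    simp

theorem symbolDeriv_add_const_mul {a b : (Fin N → ℝ) → (Fin N → ℝ) → ℂ}
    (ha : ContDiff ℝ ∞ fun p : (Fin N → ℝ) × (Fin N → ℝ) => a p.1 p.2)
    (hb : ContDiff ℝ ∞ fun p : (Fin N → ℝ) × (Fin N → ℝ) => b p.1 p.2) (c : ℂ)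
    (Lx Lθ : List (Fin N)) :
    symbolDeriv Lx Lθ (fun x θ => a x θ + c * b x θ)
      = fun x θ => symbolDeriv Lx Lθ a x θ + c * symbolDeriv Lx Lθ b x θ := by
  rw [symbolDeriv, foldr_pdTheta_add_const_mul ha hb, foldr_pdX_add_const_mul
    (contDiff_foldr_pdTheta ha Lθ) (contDiff_foldr_pdTheta hb Lθ)]
  rfl

/-- Spatial derivatives of the family `b` scale like powers of `l`, uniformly relative to `w`. -/
structure IsSpatialFamily (l w : ℕ → ℝ) (b : ℕ → (Fin N → ℝ) → (Fin N → ℝ) → ℂ) : Prop where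
  test : ∀ n, IsTestSymbol (b n)
  bound : ∀ Lx : List (Fin N), ∃ C, 0 ≤ C ∧ ∀ n x θ,
    ‖Lx.foldr pdX (b n) x θ‖ ≤ C * w n * l n ^ Lx.length

/-- The derivatives of the family `b` scale like those of a symbol of order zero adapted to the
scale `l`, uniformly relative to `w`. -/
structure IsScaledFamily (l w : ℕ → ℝ) (b : ℕ → (Fin N → ℝ) → (Fin N → ℝ) → ℂ) : Prop where
  test : ∀ n, IsTestSymbol (b n)
  bound : ∀ Lx Lθ : List (Fin N), ∃ C, 0 ≤ C ∧ ∀ n x θ,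
    ‖symbolDeriv Lx Lθ (b n) x θ‖ ≤ C * w n * l n ^ Lx.length * (l n)⁻¹ ^ Lθ.length

variable {l w : ℕ → ℝ} {b : ℕ → (Fin N → ℝ) → (Fin N → ℝ) → ℂ}

theorem IsScaledFamily.isSpatialFamily (hb : IsScaledFamily l w b) : IsSpatialFamily l w b where
  test := hb.test
  bound Lx := by simpa [symbolDeriv] using hb.bound Lx []

theorem IsSpatialFamily.sub_pdX (hl : ∀ n, 0 < l n) (hb : IsSpatialFamily l w b) (k : Fin N) :
    IsSpatialFamily l w fun n x θ => b n x θ - ((l n)⁻¹ : ℝ) * pdX k (b n) x θ where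
  test n := (hb.test n).sub_const_mul ((hb.test n).pdX k) _
  bound Lx := by
    obtain ⟨C₁, hC₁, h₁⟩ := hb.bound Lx
    obtain ⟨C₂, hC₂, h₂⟩ := hb.bound (Lx ++ [k])
    refine ⟨C₁ + C₂, by positivity, fun n x θ => ?_⟩
    have hln := hl n
    have e := congrFun (congrFun (foldr_pdX_add_const_mul (hb.test n).smooth
      ((hb.test n).pdX k).smooth (-((l n)⁻¹ : ℝ)) Lx) x) θ
    simp only [neg_mul, ← sub_eq_add_neg] at e
    rw [e]
    have h₂' := h₂ n x θ
    rw [List.foldr_append, List.foldr_cons, List.foldr_nil, List.length_append,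
      List.length_singleton] at h₂'
    refine (norm_sub_le _ _).trans ?_
    rw [norm_mul, Complex.norm_real, Real.norm_of_nonneg (by positivity)]
    calc _ ≤ C₁ * w n * l n ^ Lx.length + (l n)⁻¹ * (C₂ * w n * l n ^ (Lx.length + 1)) := by
          gcongr
          exact h₁ n x θ
      _ = _ := by rw [pow_succ]; field_simp

theorem IsScaledFamily.sub_pdTheta (hl : ∀ n, 0 < l n) (hb : IsScaledFamily l w b) (k : Fin N) :
    IsScaledFamily l w fun n x θ => b n x θ - (l n : ℝ) * pdTheta k (b n) x θ where
  test n := (hb.test n).sub_const_mul ((hb.test n).pdTheta k) _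
  bound Lx Lθ := by
    obtain ⟨C₁, hC₁, h₁⟩ := hb.bound Lx Lθ
    obtain ⟨C₂, hC₂, h₂⟩ := hb.bound Lx (Lθ ++ [k])
    refine ⟨C₁ + C₂, by positivity, fun n x θ => ?_⟩
    have hln := hl n
    have e := congrFun (congrFun (symbolDeriv_add_const_mul (hb.test n).smooth
      ((hb.test n).pdTheta k).smooth (-(l n : ℝ)) Lx Lθ) x) θ
    simp only [neg_mul, ← sub_eq_add_neg] at e
    rw [e]
    have h₂' := h₂ n x θ
    rw [symbolDeriv, List.foldr_append, List.foldr_cons, List.foldr_nil, List.length_append,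
      List.length_singleton] at h₂'
    refine (norm_sub_le _ _).trans ?_
    rw [norm_mul, Complex.norm_real, Real.norm_of_nonneg (by positivity)]
    calc _ ≤ C₁ * w n * l n ^ Lx.length * (l n)⁻¹ ^ Lθ.length
          + l n * (C₂ * w n * l n ^ Lx.length * (l n)⁻¹ ^ (Lθ.length + 1)) := by
          gcongr
          · exact h₁ n x θ
          · exact h₂'
      _ = _ := by rw [pow_succ]; field_simp

theorem IsSpatialFamily.exists_norm_oscForm_le (hl : ∀ n, 0 < l n) (hw : ∀ n, 0 ≤ w n)
    (R S T : List (Fin N)) (hS : ∀ k, k ∈ S) (hT : ∀ k, k ∈ R ∨ k ∈ T)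
    (hb : IsSpatialFamily l w b) :
    ∃ C, 0 ≤ C ∧ ∀ n (f γ : (Fin N → ℝ) → ℂ), Integrable f → MemLp f 2 → Integrable γ →
      MemLp γ 2 → ‖oscForm (l n) (b n) S T f γ‖
        ≤ C * w n * (eLpNorm f 2 volume).toReal * (eLpNorm γ 2 volume).toReal := by
  induction R generalizing S T b with
  | nil =>
    obtain ⟨C, hC, h⟩ := hb.bound []
    simp only [List.foldr_nil, List.length_nil, pow_zero, mul_one] at h
    refine ⟨C, hC, fun n f γ hf hf2 hγ hγ2 => ?_⟩
    exact norm_oscForm_le (hl n) hS (fun k => by simpa using hT k) hf hf2 hγ hγ2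
      (mul_nonneg hC (hw n)) (h n)
  | cons k R ih =>
    have hT' : ∀ j, j ∈ R ∨ j ∈ k :: T := fun j => by
      rcases hT j with h | h
      · rcases List.mem_cons.1 h with h | h
        · exact Or.inr (by simp [h])
        · exact Or.inl h
      · exact Or.inr (List.mem_cons_of_mem _ h)
    obtain ⟨C₁, hC₁, h₁⟩ := ih S (k :: T) hS hT' (hb.sub_pdX hl k)
    obtain ⟨C₂, hC₂, h₂⟩ := ih (k :: S) (k :: T) (fun j => List.mem_cons_of_mem _ (hS j)) hT' hb
    refine ⟨C₁ + ‖2 * (Real.pi : ℂ) * Complex.I * S.count k‖ * C₂, by positivity,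
      fun n f γ hf hf2 hγ hγ2 => ?_⟩
    rw [oscForm_cons_right (hb.test n) (hl n).ne' S T k hf hγ]
    refine (norm_add_le _ _).trans ?_
    rw [norm_mul]
    have e1 := h₁ n f γ hf hf2 hγ hγ2
    have e2 := mul_le_mul_of_nonneg_left (h₂ n f γ hf hf2 hγ hγ2)
      (norm_nonneg (2 * (Real.pi : ℂ) * Complex.I * S.count k))
    refine (add_le_add e1 e2).trans_eq ?_
    ring

theorem IsScaledFamily.exists_norm_oscForm_le_of_list (hl : ∀ n, 0 < l n) (hw : ∀ n, 0 ≤ w n)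
    (R S : List (Fin N)) (hS : ∀ k, k ∈ R ∨ k ∈ S) (hb : IsScaledFamily l w b) :
    ∃ C, 0 ≤ C ∧ ∀ n (f γ : (Fin N → ℝ) → ℂ), Integrable f → MemLp f 2 → Integrable γ →
      MemLp γ 2 → ‖oscForm (l n) (b n) S [] f γ‖
        ≤ C * w n * (eLpNorm f 2 volume).toReal * (eLpNorm γ 2 volume).toReal := by
  induction R generalizing S b with
  | nil =>
    exact hb.isSpatialFamily.exists_norm_oscForm_le hl hw (List.finRange N) S []
      (fun k => by simpa using hS k) (fun k => Or.inl (List.mem_finRange k))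
  | cons k R ih =>
    have hS' : ∀ j, j ∈ R ∨ j ∈ k :: S := fun j => by
      rcases hS j with h | h
      · rcases List.mem_cons.1 h with h | h
        · exact Or.inr (by simp [h])
        · exact Or.inl h
      · exact Or.inr (List.mem_cons_of_mem _ h)
    obtain ⟨C, hC, h⟩ := ih (k :: S) hS' (hb.sub_pdTheta hl k)
    refine ⟨C, hC, fun n f γ hf hf2 hγ hγ2 => ?_⟩
    rw [oscForm_cons_left (hb.test n) (l n) S k hf hγ]
    exact h n f γ hf hf2 hγ hγ2

/-- Uniform `L²` bound for the bilinear forms of the operators with amplitudes `b n`. -/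
theorem IsScaledFamily.exists_norm_integral_le (hl : ∀ n, 0 < l n) (hw : ∀ n, 0 ≤ w n)
    (hb : IsScaledFamily l w b) :
    ∃ C, 0 ≤ C ∧ ∀ n (g h : 𝓢(Fin N → ℝ, ℂ)),
      ‖∫ x, (∫ ξ, b n x ξ * osc x ξ * h ξ) * g x‖
        ≤ C * w n * (eLpNorm h 2 volume).toReal * (eLpNorm g 2 volume).toReal := by
  obtain ⟨C, hC, H⟩ := hb.exists_norm_oscForm_le_of_list hl hw (List.finRange N) []
    (fun k => Or.inl (List.mem_finRange k))
  refine ⟨C, hC, fun n g h => ?_⟩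
  obtain ⟨f, hf, hf2, hfh⟩ := exists_fourierT_eq h
  obtain ⟨γ, hγ, hγ2, hγg⟩ := exists_fourierT_eq g
  have e := H n f γ hf hf2 hγ hγ2
  rw [← eLpNorm_fourierT hf hf2, ← eLpNorm_fourierT hγ hγ2, hfh, hγg] at e
  have i := integrable_oscForm (hb.test n) (l n) [] [] hf hγ
  rw [oscForm, integral_prod _ i] at e
  simpa only [windowedFourier_nil, hfh, hγg, integral_mul_const] using e

end Families

section Dyadic

variable {N : ℕ} {ρ δ m : ℝ} {σ : (Fin N → ℝ) → (Fin N → ℝ) → ℂ}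

/-- A symbol whose estimates hold uniformly in the spatial variable. -/
structure IsUniformSymbol (ρ δ m : ℝ) (σ : (Fin N → ℝ) → (Fin N → ℝ) → ℂ) : Prop where
  smooth : ContDiff ℝ ∞ fun p : (Fin N → ℝ) × (Fin N → ℝ) => σ p.1 p.2
  bound : ∀ Lx Lθ : List (Fin N), ∃ C, 0 ≤ C ∧ ∀ x θ,
    ‖symbolDeriv Lx Lθ σ x θ‖ ≤ C * jweight (m - ρ * Lθ.length + δ * Lx.length) θ

theorem jweight_pos (s : ℝ) (θ : Fin N → ℝ) : 0 < jweight s θ :=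
  Real.rpow_pos_of_pos (by positivity) _

theorem symbolDeriv_eq_zero {K₀ : Set (Fin N → ℝ)} (hK₀ : IsClosed K₀)
    (hσ : ∀ x, x ∉ K₀ → ∀ ξ, σ x ξ = 0) (Lx Lθ : List (Fin N)) (x : Fin N → ℝ) (hx : x ∉ K₀)
    (ξ : Fin N → ℝ) : symbolDeriv Lx Lθ σ x ξ = 0 := by
  have h : ∀ x, x ∉ K₀ → ∀ ξ, Lθ.foldr pdTheta σ x ξ = 0 := by
    induction Lθ with
    | nil => exact hσ
    | cons k L ih =>
      intro x hx ξ
      simp [pdTheta, funext (ih x hx)]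
  rw [symbolDeriv]
  generalize Lθ.foldr pdTheta σ = τ at h
  induction Lx generalizing x ξ with
  | nil => exact h x hx ξ
  | cons k L ih =>
    have he : (fun x' => L.foldr pdX τ x' ξ) =ᶠ[𝓝 x] fun _ => 0 := by
      filter_upwards [hK₀.isOpen_compl.mem_nhds hx] with y hy using ih y hy ξ
    rw [List.foldr_cons, pdX, he.fderiv_eq]
    simp

theorem IsHormanderSymbol.isUniformSymbol (hσ : IsHormanderSymbol ρ δ m Set.univ σ)
    {K₀ : Set (Fin N → ℝ)} (hK₀ : IsCompact K₀) (h0 : ∀ x, x ∉ K₀ → ∀ ξ, σ x ξ = 0) :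
    IsUniformSymbol ρ δ m σ where
  smooth := by
    have := hσ.1
    rwa [Set.univ_prod_univ, contDiffOn_univ] at this
  bound Lx Lθ := by
    obtain ⟨C, hC, h⟩ := hσ.2 K₀ (Set.subset_univ _) hK₀ Lx Lθ
    refine ⟨C, hC, fun x θ => ?_⟩
    by_cases hx : x ∈ K₀
    · exact h x hx θ
    · rw [symbolDeriv_eq_zero hK₀.isClosed h0 Lx Lθ x hx θ, norm_zero]
      exact mul_nonneg hC (jweight_pos _ _).le

theorem IsUniformSymbol.pdTheta (hσ : IsUniformSymbol ρ δ m σ) (k : Fin N) :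
    IsUniformSymbol ρ δ (m - ρ) (pdTheta k σ) where
  smooth := contDiff_pdTheta hσ.smooth k
  bound Lx Lθ := by
    obtain ⟨C, hC, h⟩ := hσ.bound Lx (Lθ ++ [k])
    refine ⟨C, hC, fun x θ => ?_⟩
    have := h x θ
    rw [symbolDeriv, List.foldr_append, List.foldr_cons, List.foldr_nil, List.length_append,
      List.length_singleton] at this
    refine this.trans_eq ?_
    congr 2
    push_cast
    ring

/-- A smooth function supported in the annulus `1 ≤ ‖θ‖ ≤ 4`. -/
structure IsAnnular (c : (Fin N → ℝ) → ℂ) : Prop where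
  smooth : ContDiff ℝ ∞ c
  support : tsupport c ⊆ {θ | 1 ≤ ‖θ‖ ∧ ‖θ‖ ≤ 4}

variable {c : (Fin N → ℝ) → ℂ}

theorem IsAnnular.hasCompactSupport (hc : IsAnnular c) : HasCompactSupport c :=
  HasCompactSupport.intro (isCompact_closedBall (0 : Fin N → ℝ) 4) fun θ hθ => by
    by_contra h
    exact hθ (by simpa using (hc.support (subset_tsupport _ h)).2)

theorem IsAnnular.fderiv (hc : IsAnnular c) (k : Fin N) :
    IsAnnular fun θ => fderiv ℝ c θ (Pi.single k 1) where
  smooth := (hc.smooth.fderiv_right (m := ∞) (by simp)).clm_apply contDiff_const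
  support := (tsupport_fderiv_apply_subset ℝ _).trans hc.support

theorem jweight_le_of_annulus (s : ℝ) {r : ℝ} (hr : 1 ≤ r) {θ : Fin N → ℝ} (h1 : r ≤ ‖θ‖)
    (h2 : ‖θ‖ ≤ 4 * r) : jweight s θ ≤ 17 ^ (|s| / 2) * r ^ s := by
  have hr0 : 0 < r := by linarith
  have e : r ^ s = (r ^ 2) ^ (s / 2) := by
    rw [← Real.rpow_natCast, ← Real.rpow_mul hr0.le]
    congr 1
    push_cast
    ring
  have hlow : r ^ 2 ≤ 1 + ‖θ‖ ^ 2 := by nlinarith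
  have hupp : 1 + ‖θ‖ ^ 2 ≤ 17 * r ^ 2 := by nlinarith [norm_nonneg θ]
  rw [e, jweight]
  rcases le_total 0 s with hs | hs
  · rw [abs_of_nonneg hs, ← Real.mul_rpow (by norm_num) (by positivity)]
    exact Real.rpow_le_rpow (by positivity) hupp (by linarith)
  · refine (Real.rpow_le_rpow_of_nonpos (by positivity) hlow (by linarith)).trans ?_
    exact le_mul_of_one_le_left (by positivity)
      (Real.one_le_rpow (by norm_num) (by positivity))

theorem foldr_pdX_mul_right {τ : (Fin N → ℝ) → (Fin N → ℝ) → ℂ}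
    (hτ : ContDiff ℝ ∞ fun p : (Fin N → ℝ) × (Fin N → ℝ) => τ p.1 p.2) (χ : (Fin N → ℝ) → ℂ)
    (L : List (Fin N)) :
    L.foldr pdX (fun x θ => τ x θ * χ θ) = fun x θ => L.foldr pdX τ x θ * χ θ := by
  induction L with
  | nil => rfl
  | cons k L ih =>
    simp only [List.foldr_cons, ih]
    ext x θ
    simp only [pdX]
    rw [fderiv_mul_const (differentiable_slice_left (contDiff_foldr_pdX hτ L) θ x)]
    simp [mul_comm]

theorem pdTheta_mul_dilate (hσ : ContDiff ℝ ∞ fun p : (Fin N → ℝ) × (Fin N → ℝ) => σ p.1 p.2)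
    (hc : ContDiff ℝ ∞ c) (r : ℝ) (k : Fin N) :
    pdTheta k (fun x θ => σ x θ * c (r • θ))
      = fun x θ => pdTheta k σ x θ * c (r • θ)
        + r * (σ x θ * fderiv ℝ c (r • θ) (Pi.single k 1)) := by
  ext x θ
  have h : HasFDerivAt (fun θ => c (r • θ)) ((fderiv ℝ c (r • θ)).comp
      (r • ContinuousLinearMap.id ℝ (Fin N → ℝ))) θ :=
    HasFDerivAt.comp (f := fun θ => r • θ) θ
      (hc.differentiable (by simp) (r • θ)).hasFDerivAt ((hasFDerivAt_id θ).const_smul r)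
  simp only [pdTheta]
  rw [fderiv_fun_mul (differentiable_slice_right hσ x θ) h.differentiableAt, h.fderiv]
  simp
  ring

theorem contDiff_mul_dilate (hσ : ContDiff ℝ ∞ fun p : (Fin N → ℝ) × (Fin N → ℝ) => σ p.1 p.2)
    (hc : ContDiff ℝ ∞ c) (r : ℝ) :
    ContDiff ℝ ∞ fun p : (Fin N → ℝ) × (Fin N → ℝ) => σ p.1 p.2 * c (r • p.2) :=
  hσ.mul (hc.comp (contDiff_snd.const_smul r))

theorem IsUniformSymbol.exists_norm_dyadic_le (hρ1 : ρ ≤ 1) (hσ : IsUniformSymbol ρ δ m σ)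
    (hc : IsAnnular c) (Lx Lθ : List (Fin N)) :
    ∃ C, 0 ≤ C ∧ ∀ (n : ℕ) x θ,
      ‖symbolDeriv Lx Lθ (fun x θ => σ x θ * c (((2 : ℝ) ^ n)⁻¹ • θ)) x θ‖
        ≤ C * ((2 : ℝ) ^ n) ^ (m + δ * Lx.length - ρ * Lθ.length) := by
  induction Lθ using List.reverseRecOn generalizing m σ c with
  | nil =>
    obtain ⟨C, hC, h⟩ := hσ.bound Lx []
    obtain ⟨M, hM⟩ := hc.smooth.continuous.bounded_above_of_compact_support hc.hasCompactSupport
    have hM0 : 0 ≤ M := (norm_nonneg _).trans (hM 0)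
    refine ⟨C * 17 ^ (|m + δ * Lx.length| / 2) * M, by positivity, fun n x θ => ?_⟩
    rw [symbolDeriv, List.foldr_nil, foldr_pdX_mul_right hσ.smooth, norm_mul]
    have h' := h x θ
    simp only [symbolDeriv, List.foldr_nil, List.length_nil, Nat.cast_zero, mul_zero,
      sub_zero] at h' ⊢
    have hn : (1 : ℝ) ≤ 2 ^ n := one_le_pow₀ (by norm_num)
    by_cases h0 : c (((2 : ℝ) ^ n)⁻¹ • θ) = 0
    · rw [h0, norm_zero, mul_zero]
      positivity
    · have hs := hc.support (subset_tsupport _ h0)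
      simp only [Set.mem_ofPred_eq, norm_smul, norm_inv, norm_pow, Real.norm_ofNat] at hs
      have h1 : (2 : ℝ) ^ n ≤ ‖θ‖ := by
        have := hs.1
        rwa [inv_mul_eq_div, one_le_div (by positivity)] at this
      have h2 : ‖θ‖ ≤ 4 * 2 ^ n := by
        have := hs.2
        rwa [inv_mul_eq_div, div_le_iff₀ (by positivity)] at this
      have := jweight_le_of_annulus (m + δ * Lx.length) hn h1 h2
      calc _ ≤ C * (17 ^ (|m + δ * Lx.length| / 2) * ((2 : ℝ) ^ n) ^ (m + δ * Lx.length)) * M := by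
            refine mul_le_mul (h'.trans ?_) (hM _) (norm_nonneg _) (by positivity)
            gcongr
        _ = _ := by ring
  | append_singleton L k ih =>
    obtain ⟨C₁, hC₁, h₁⟩ := ih (hσ.pdTheta k) hc
    obtain ⟨C₂, hC₂, h₂⟩ := ih hσ (hc.fderiv k)
    refine ⟨C₁ + C₂, by positivity, fun n x θ => ?_⟩
    have hn : (1 : ℝ) ≤ 2 ^ n := one_le_pow₀ (by norm_num)
    have e : symbolDeriv Lx (L ++ [k]) (fun x θ => σ x θ * c (((2 : ℝ) ^ n)⁻¹ • θ))
        = symbolDeriv Lx L (_root_.pdTheta k fun x θ => σ x θ * c (((2 : ℝ) ^ n)⁻¹ • θ)) := by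
      rw [symbolDeriv, symbolDeriv, List.foldr_append, List.foldr_cons, List.foldr_nil]
    rw [e, pdTheta_mul_dilate hσ.smooth hc.smooth, symbolDeriv_add_const_mul
      (contDiff_mul_dilate (hσ.pdTheta k).smooth hc.smooth _)
      (contDiff_mul_dilate hσ.smooth (hc.fderiv k).smooth _)]
    refine (norm_add_le _ _).trans ?_
    rw [norm_mul, Complex.norm_real, Real.norm_of_nonneg (by positivity), add_mul]
    have e1 := h₁ n x θ
    have e2 := h₂ n x θ
    refine add_le_add (e1.trans_eq ?_) ?_
    · congr 2
      push_cast [List.length_append, List.length_singleton]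
      ring
    · calc _ ≤ ((2 : ℝ) ^ n)⁻¹ * (C₂ * ((2 : ℝ) ^ n) ^ (m + δ * Lx.length - ρ * L.length)) := by
            gcongr
        _ = C₂ * ((2 : ℝ) ^ n) ^ (m + δ * Lx.length - ρ * L.length + (-1)) := by
            rw [Real.rpow_add (by positivity), Real.rpow_neg_one]
            ring
        _ ≤ _ := by
            gcongr
            push_cast [List.length_append, List.length_singleton]
            linarith

theorem isTestSymbol_mul_dilate {K₀ : Set (Fin N → ℝ)} (hK₀ : IsCompact K₀)
    (hσ : ContDiff ℝ ∞ fun p : (Fin N → ℝ) × (Fin N → ℝ) => σ p.1 p.2)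
    (h0 : ∀ x, x ∉ K₀ → ∀ ξ, σ x ξ = 0) (hc : ContDiff ℝ ∞ c) (hcs : HasCompactSupport c)
    {r : ℝ} (hr : r ≠ 0) : IsTestSymbol fun x θ => σ x θ * c (r • θ) where
  smooth := contDiff_mul_dilate hσ hc r
  compact := by
    have hcr : HasCompactSupport fun θ => c (r • θ) :=
      hcs.comp_homeomorph (Homeomorph.smulOfNeZero r hr)
    refine HasCompactSupport.intro (hK₀.prod hcr) fun p hp => ?_
    by_cases hx : p.1 ∈ K₀
    · have : p.2 ∉ tsupport fun θ => c (r • θ) := fun h => hp ⟨hx, h⟩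
      rw [image_eq_zero_of_notMem_tsupport this, mul_zero]
    · rw [h0 _ hx, zero_mul]

/-- The dyadic pieces of a symbol form a family adapted to the scales `2^{nρ}`. -/
theorem IsUniformSymbol.isScaledFamily (hδρ : δ ≤ ρ) (hρ1 : ρ ≤ 1)
    (hσ : IsUniformSymbol ρ δ m σ) {K₀ : Set (Fin N → ℝ)} (hK₀ : IsCompact K₀)
    (h0 : ∀ x, x ∉ K₀ → ∀ ξ, σ x ξ = 0) (hc : IsAnnular c) :
    IsScaledFamily (fun n => ((2 : ℝ) ^ n) ^ ρ) (fun n => ((2 : ℝ) ^ n) ^ m)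
      fun n x θ => σ x θ * c (((2 : ℝ) ^ n)⁻¹ • θ) where
  test n := isTestSymbol_mul_dilate hK₀ hσ.smooth h0 hc.smooth hc.hasCompactSupport
    (by positivity)
  bound Lx Lθ := by
    obtain ⟨C, hC, h⟩ := hσ.exists_norm_dyadic_le hρ1 hc Lx Lθ
    refine ⟨C, hC, fun n x θ => (h n x θ).trans ?_⟩
    have hn : (1 : ℝ) ≤ 2 ^ n := one_le_pow₀ (by norm_num)
    have hp : (0 : ℝ) < 2 ^ n := by positivity
    rw [← Real.rpow_neg hp.le, ← Real.rpow_mul_natCast hp.le, ← Real.rpow_mul_natCast hp.le,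
      mul_assoc, mul_assoc, ← Real.rpow_add hp, ← Real.rpow_add hp]
    gcongr
    have : δ * (Lx.length : ℝ) ≤ ρ * Lx.length := by gcongr
    linarith

end Dyadic

section Assembly

variable {N : ℕ}

theorem exists_dyadic_cutoff (N : ℕ) : ∃ χ : (Fin N → ℝ) → ℂ, ContDiff ℝ ∞ χ ∧
    HasCompactSupport χ ∧ (∀ θ, ‖θ‖ ≤ 1 → χ θ = 1) ∧ (∀ θ, ‖χ θ‖ ≤ 1) ∧
    IsAnnular fun θ => χ ((2 : ℝ)⁻¹ • θ) - χ θ := by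
  let Θ : ContDiffBump (0 : Fin N → ℝ) := ⟨1, 2, one_pos, one_lt_two⟩
  have hs : ContDiff ℝ ∞ fun θ => (Θ θ : ℂ) := Complex.ofRealCLM.contDiff.comp Θ.contDiff
  have h1 : ∀ θ : Fin N → ℝ, ‖θ‖ ≤ 1 → Θ θ = 1 := fun θ hθ =>
    Θ.one_of_mem_closedBall (by simpa using hθ)
  have h0 : ∀ θ : Fin N → ℝ, 2 ≤ ‖θ‖ → Θ θ = 0 := fun θ hθ =>
    Θ.zero_of_le_dist (by simpa using hθ)
  refine ⟨fun θ => (Θ θ : ℂ), hs, ?_, fun θ hθ => by simp [h1 θ hθ], fun θ => ?_,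
    (hs.comp (contDiff_id.const_smul _)).sub hs, ?_⟩
  · exact Θ.hasCompactSupport.comp_left Complex.ofReal_zero
  · rw [Complex.norm_real, Real.norm_of_nonneg Θ.nonneg]
    exact Θ.le_one
  · refine closure_minimal (fun θ hθ => ?_) ?_
    · by_contra h
      refine hθ ?_
      have hn : ‖(2 : ℝ)⁻¹ • θ‖ = ‖θ‖ / 2 := by
        rw [norm_smul, norm_inv, Real.norm_ofNat, inv_mul_eq_div]
      rw [Set.mem_ofPred_eq, not_and_or, not_le, not_le] at h
      rcases h with h | h
      · simp [h1 θ h.le, h1 ((2 : ℝ)⁻¹ • θ) (by rw [hn]; linarith)]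
      · simp [h0 θ (by linarith), h0 ((2 : ℝ)⁻¹ • θ) (by rw [hn]; linarith)]
    · exact (isClosed_le continuous_const continuous_norm).inter
        (isClosed_le continuous_norm continuous_const)

theorem integrable_fourierT (f : 𝓢(Fin N → ℝ, ℂ)) : Integrable (fourierT f) := by
  let fE : 𝓢(EuclideanSpace ℝ (Fin N), ℂ) :=
    SchwartzMap.compCLMOfContinuousLinearEquiv ℂ (EuclideanSpace.equiv (Fin N) ℝ) f
  have h := (𝓕 fE : 𝓢(EuclideanSpace ℝ (Fin N), ℂ)).integrable (μ := volume)
  rw [← (PiLp.volume_preserving_toLp (Fin N)).integrable_comp_emb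
    (MeasurableEquiv.toLp 2 (Fin N → ℝ)).measurableEmbedding] at h
  refine h.congr (.of_forall fun ξ => ?_)
  have h1 := fourierT_ofLp (f : (Fin N → ℝ) → ℂ) (WithLp.toLp 2 ξ)
  rw [Function.comp_apply, SchwartzMap.fourier_coe]
  exact h1.symm

/-- The complex conjugate of a Schwartz function. -/
noncomputable def schwartzConj (g : 𝓢(Fin N → ℝ, ℂ)) : 𝓢(Fin N → ℝ, ℂ) where
  toFun x := Complex.conjLIE (g x)
  smooth' := Complex.conjLIE.contDiff.comp (g.smooth ⊤)
  decay' k n := by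
    obtain ⟨C, hC⟩ := g.decay' k n
    refine ⟨C, fun x => ?_⟩
    have := Complex.conjLIE.norm_iteratedFDeriv_comp_left g x n
    exact (congrArg (‖x‖ ^ k * ·) this).trans_le (hC x)

theorem norm_le_of_forall_schwartz
    {D : Lp ℂ 2 (volume : Measure (Fin N → ℝ)) →L[ℂ] Lp ℂ 2 (volume : Measure (Fin N → ℝ))}
    {C : ℝ} (hC : 0 ≤ C)
    (hD : ∀ g h : 𝓢(Fin N → ℝ, ℂ), ‖∫ x, D (h.toLp 2) x * g x‖
      ≤ C * (eLpNorm h 2 volume).toReal * (eLpNorm g 2 volume).toReal) : ‖D‖ ≤ C := by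
  have hdense := SchwartzMap.denseRange_toLpCLM (E := Fin N → ℝ) (F := ℂ) (p := 2)
    (by norm_num) (μ := volume)
  have key : ∀ x y : Lp ℂ 2 (volume : Measure (Fin N → ℝ)),
      ‖inner ℂ y (D x)‖ ≤ C * ‖x‖ * ‖y‖ := by
    refine hdense.induction_on₂ (isClosed_le (by fun_prop) (by fun_prop)) fun h g => ?_
    have e : inner ℂ (g.toLp 2 : Lp ℂ 2 (volume : Measure (Fin N → ℝ))) (D (h.toLp 2))
        = ∫ x, D (h.toLp 2) x * schwartzConj g x := by
      rw [L2.inner_def]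
      refine integral_congr_ae ?_
      filter_upwards [g.coeFn_toLp 2] with x hx
      rw [hx]
      rfl
    have e2 : eLpNorm (schwartzConj g) 2 volume = eLpNorm g 2 volume :=
      eLpNorm_congr_norm_ae (.of_forall fun x => Complex.conjLIE.norm_map (g x))
    have h1 := hD (schwartzConj g) h
    rw [← e, e2, ← SchwartzMap.norm_toLp, ← SchwartzMap.norm_toLp] at h1
    exact h1
  refine D.opNorm_le_bound hC fun x => ?_
  have h := key x (D x)
  rw [inner_self_eq_norm_sq_to_K, norm_pow, RCLike.norm_ofReal, abs_norm, sq] at h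
  rcases eq_or_lt_of_le (norm_nonneg (D x)) with h0 | h0
  · rw [← h0]
    positivity
  · exact le_of_mul_le_mul_right h h0

end Assembly

section Compactness

variable {N : ℕ} {ρ δ m : ℝ} {σ : (Fin N → ℝ) → (Fin N → ℝ) → ℂ}

theorem IsUniformSymbol.exists_norm_le (hm : m ≤ 0) (hσ : IsUniformSymbol ρ δ m σ) :
    ∃ C, 0 ≤ C ∧ ∀ x θ, ‖σ x θ‖ ≤ C := by
  obtain ⟨C, hC, h⟩ := hσ.bound [] []
  refine ⟨C, hC, fun x θ => (h x θ).trans (mul_le_of_le_one_right hC ?_)⟩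
  refine Real.rpow_le_one_of_one_le_of_nonpos (by nlinarith [sq_nonneg ‖θ‖]) ?_
  simp only [List.length_nil, Nat.cast_zero, mul_zero]
  linarith

/-- The integral operators obtained by cutting off the frequencies of `σ` dyadically converge
pointwise to the pseudodifferential operator. -/
theorem IsUniformSymbol.tendsto_integral_cutoff (hm : m ≤ 0) (hσ : IsUniformSymbol ρ δ m σ)
    {χ : (Fin N → ℝ) → ℂ} (hχ : Continuous χ) (hχ1 : ∀ θ, ‖θ‖ ≤ 1 → χ θ = 1)
    (hχle : ∀ θ, ‖χ θ‖ ≤ 1) (f : 𝓢(Fin N → ℝ, ℂ)) (x : Fin N → ℝ) :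
    Tendsto (fun n : ℕ => ∫ ξ, σ x ξ * χ (((2 : ℝ) ^ n)⁻¹ • ξ) * osc x ξ * fourierT f ξ) atTop
      (𝓝 (pdoApply σ f x)) := by
  obtain ⟨C, hC, hle⟩ := hσ.exists_norm_le hm
  have hf := integrable_fourierT f
  have hσx : Continuous (σ x) := hσ.smooth.continuous.comp (Continuous.prodMk_right x)
  refine tendsto_integral_of_dominated_convergence (fun ξ => C * ‖fourierT f ξ‖) (fun n => ?_)
    (hf.norm.const_mul C) (fun n => .of_forall fun ξ => ?_) (.of_forall fun ξ => ?_)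
  · exact ((hσx.mul (hχ.comp (continuous_const_smul _))).mul
      (continuous_osc_right x)).aestronglyMeasurable.mul hf.aestronglyMeasurable
  · rw [norm_mul, norm_mul, norm_mul, norm_osc, mul_one]
    gcongr
    exact (mul_le_of_le_one_right (norm_nonneg _) (hχle _)).trans (hle x ξ)
  · refine tendsto_const_nhds.congr' ?_
    filter_upwards [(tendsto_pow_atTop_atTop_of_one_lt (one_lt_two (α := ℝ))).eventually_ge_atTop
      ‖ξ‖] with n hn
    rw [hχ1, mul_one, mul_comm (σ x ξ), osc]
    rw [norm_smul, norm_inv, norm_pow, Real.norm_ofNat, inv_mul_le_one₀ (by positivity)]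
    exact hn

end Compactness

/-- second part of Proposition 5.2: a compactly supported
pseudodifferential operator of negative order `m < 0` extends to a bounded operator on
`L²(ℝ^N)` which is moreover a compact operator. The extension is specified by the property
that it agrees with `A_σ` on (the `L²`-classes of) Schwartz functions. -/
theorem pdo_negative_order_compact {N : ℕ} (hN : 1 ≤ N)
    (ρ δ : ℝ) (hδ0 : 0 ≤ δ) (hδρ : δ < ρ) (hρ1 : ρ ≤ 1)
    (m : ℝ) (hm : m < 0)
    (σ : (Fin N → ℝ) → (Fin N → ℝ) → ℂ)
    (hσ : IsHormanderSymbol ρ δ m Set.univ σ)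
    (K₀ : Set (Fin N → ℝ)) (hK₀ : IsCompact K₀)
    (hσsupp : ∀ x : Fin N → ℝ, x ∉ K₀ → ∀ ξ : Fin N → ℝ, σ x ξ = 0) :
    ∃ A : Lp ℂ 2 (volume : Measure (Fin N → ℝ)) →L[ℂ] Lp ℂ 2 (volume : Measure (Fin N → ℝ)),
      IsCompactOperator A ∧
      ∀ f : SchwartzMap (Fin N → ℝ) ℂ,
        ∀ g : Lp ℂ 2 (volume : Measure (Fin N → ℝ)),
          (⇑g =ᵐ[volume] ⇑f) → ⇑(A g) =ᵐ[volume] pdoApply σ ⇑f := by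
  have hu := hσ.isUniformSymbol hK₀ hσsupp
  obtain ⟨χ, hχs, hχc, hχ1, hχle, hann⟩ := exists_dyadic_cutoff N
  have htest : ∀ n : ℕ, IsTestSymbol fun x θ => σ x θ * χ (((2 : ℝ) ^ n)⁻¹ • θ) := fun n =>
    isTestSymbol_mul_dilate hK₀ hu.smooth hσsupp hχs hχc (by positivity)
  have hop : ∀ n : ℕ, ∃ T : Lp ℂ 2 (volume : Measure (Fin N → ℝ)) →L[ℂ]
      Lp ℂ 2 (volume : Measure (Fin N → ℝ)), IsCompactOperator T ∧ ∀ h, ⇑(T h) =ᵐ[volume]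
        fun x => ∫ ξ, σ x ξ * χ (((2 : ℝ) ^ n)⁻¹ • ξ) * osc x ξ * h ξ := fun n =>
    exists_kernel_operator ((htest n).smooth.continuous.mul continuous_osc)
      (htest n).compact.mul_right
  choose T hTc hT using hop
  obtain ⟨C, hC, hle⟩ := (hu.isScaledFamily hδρ.le hρ1 hK₀ hσsupp hann).exists_norm_integral_le
    (fun n => by positivity) (fun n => by positivity)
  have hInt : ∀ (n : ℕ) (x : Fin N → ℝ) (h : 𝓢(Fin N → ℝ, ℂ)),
      Integrable fun ξ => σ x ξ * χ (((2 : ℝ) ^ n)⁻¹ • ξ) * osc x ξ * h ξ := fun n x h =>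
    Continuous.integrable_of_hasCompactSupport
      ((((htest n).smooth.continuous.comp (Continuous.prodMk_right x)).mul
        (continuous_osc_right x)).mul h.continuous)
      (((htest n).compact_right x).mul_right.mul_right)
  have hdist : ∀ n, dist (T n) (T (n + 1)) ≤ C * ((2 : ℝ) ^ m) ^ n := by
    intro n
    rw [dist_comm, dist_eq_norm]
    refine norm_le_of_forall_schwartz (by positivity) fun g h => ?_
    have hw : ((2 : ℝ) ^ m) ^ n = ((2 : ℝ) ^ n) ^ m := by
      rw [← Real.rpow_natCast, ← Real.rpow_natCast, ← Real.rpow_mul zero_le_two,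
        ← Real.rpow_mul zero_le_two, mul_comm]
    rw [hw]
    refine (congrArg norm (integral_congr_ae ?_)).trans_le (hle n g h)
    have hh := h.coeFn_toLp 2 (volume : Measure (Fin N → ℝ))
    filter_upwards [Lp.coeFn_sub (T (n + 1) (h.toLp 2)) (T n (h.toLp 2)), hT n (h.toLp 2),
      hT (n + 1) (h.toLp 2)] with x h1 h2 h3
    have e : ∀ k : ℕ, ∫ ξ, σ x ξ * χ (((2 : ℝ) ^ k)⁻¹ • ξ) * osc x ξ * h.toLp 2 volume ξ =
        ∫ ξ, σ x ξ * χ (((2 : ℝ) ^ k)⁻¹ • ξ) * osc x ξ * h ξ := fun k =>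
      integral_congr_ae (hh.mono fun ξ hξ => by simp only [hξ])
    rw [sub_apply, h1, Pi.sub_apply, h2, h3, e, e,
      ← integral_sub (hInt (n + 1) x h) (hInt n x h)]
    congr 1
    refine integral_congr_ae (.of_forall fun ξ => ?_)
    simp only [pow_succ', mul_inv, mul_smul]
    ring
  obtain ⟨A₀, hA₀⟩ := cauchySeq_tendsto_of_complete (cauchySeq_of_le_geometric _ C
    (Real.rpow_lt_one_of_one_lt_of_neg one_lt_two hm) hdist)
  refine ⟨A₀.comp (fourierL2 N).toContinuousLinearMap,
    (isCompactOperator_of_tendsto hA₀ (.of_forall hTc)).comp_clm _, fun f g hg => ?_⟩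
  have hF : ⇑(fourierL2 N g) =ᵐ[volume] fourierT f := by
    have hg' : g = (f.memLp 2).toLp f :=
      Lp.ext (hg.trans (f.memLp 2).coeFn_toLp.symm)
    rw [hg']
    exact fourierL2_ae_eq f.integrable (f.memLp 2)
  have hlim : Tendsto (fun n => T n (fourierL2 N g)) atTop (𝓝 (A₀ (fourierL2 N g))) :=
    ((ContinuousLinearMap.apply ℂ _ (fourierL2 N g)).continuous.tendsto A₀).comp hA₀
  obtain ⟨ns, hns, hae⟩ := (tendstoInMeasure_of_tendsto_Lp hlim).exists_seq_tendsto_ae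
  filter_upwards [hae, ae_all_iff.2 fun n => hT n (fourierL2 N g)] with x h1 h2
  refine tendsto_nhds_unique h1 (((hu.tendsto_integral_cutoff hm.le hχs.continuous hχ1 hχle f
    x).comp hns.tendsto_atTop).congr fun i => ?_)
  rw [h2, Function.comp_apply]
  exact integral_congr_ae (hF.mono fun ξ hξ => by simp only [hξ])
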